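/- There exists an absolute constant C₁ > 0 with the following property. Let g(x) = a₁·x^β + a₂ where a₁, a₂ are nonzero integers and β = β₁/β₂ is a positive rational number with β₁, β₂ positive integers. Let p, q be positive integers and let s, t ≥ 1 be real numbers with log max(p, q, |a₁|, |a₂|) ≤ s and log max(β₁, β₂) ≤ t. If g(p/q) = a₁·(p/q)^β + a₂ is nonzero, then |g(p/q)| ≥ exp(−C₁·t·s²). -/

import Mathlib

open Polynomial

/-- The binomial polynomial `X(X-1)...(X-a+1)/a!`. -/
noncomputable def Bp (a : ℕ) : ℚ[X] :=
  C ((a.factorial : ℚ)⁻¹) * ∏ i ∈ Finset.range a, (X - C (i : ℚ))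

/-- Feldman polynomials. -/
noncomputable def Qp (h a b : ℕ) : ℚ[X] := Bp a * Bp h ^ b

lemma Bp_zero : Bp 0 = 1 := by simp [Bp]

lemma Bp_pascal (a : ℕ) : (Bp (a+1)).comp (X + 1) = Bp (a+1) + Bp a := by
  have h1 : (∏ i ∈ Finset.range (a+1), (X - C (i : ℚ))).comp (X+1)
      = (X + 1) * ∏ i ∈ Finset.range a, (X - C (i : ℚ)) := by
    rw [Finset.prod_range_succ', mul_comp, prod_comp, mul_comm]
    congr 1
    · simp
    · apply Finset.prod_congr rfl
      intro i _
      simp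
  unfold Bp
  rw [mul_comp, h1, C_comp, Finset.prod_range_succ]
  have h2 : (C (((a+1).factorial : ℚ)⁻¹)) * C ((a : ℚ) + 1) = C ((a.factorial : ℚ)⁻¹) := by
    rw [← C_mul, Nat.factorial_succ]
    congr 1
    push_cast
    have : (a.factorial : ℚ) ≠ 0 := by positivity
    field_simp
  rw [← h2, C_add, C_1]
  ring

/-- polynomials `f` such that `f (x + ν w)` has integer coefficients -/
def IntAt (ν : ℕ) (x : ℕ) (f : ℚ[X]) : Prop :=
  f.comp (C (ν : ℚ) * X + C (x : ℚ)) ∈ (mapRingHom (Int.castRingHom ℚ)).range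

lemma IntAt.mul {ν x : ℕ} {f g : ℚ[X]} (hf : IntAt ν x f) (hg : IntAt ν x g) :
    IntAt ν x (f * g) := by
  unfold IntAt at *
  rw [mul_comp]; exact mul_mem hf hg

lemma IntAt.add {ν x : ℕ} {f g : ℚ[X]} (hf : IntAt ν x f) (hg : IntAt ν x g) :
    IntAt ν x (f + g) := by
  unfold IntAt at *
  rw [add_comp]; exact add_mem hf hg

lemma IntAt.one {ν x : ℕ} : IntAt ν x 1 := by
  unfold IntAt
  rw [one_comp]; exact one_mem _

lemma IntAt.pow {ν x : ℕ} {f : ℚ[X]} (hf : IntAt ν x f) (n : ℕ) : IntAt ν x (f ^ n) := by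
  induction n with
  | zero => simpa using IntAt.one
  | succ n ih => rw [pow_succ]; exact ih.mul hf

lemma IntAt.prod {ν x : ℕ} {ι : Type*} (s : Finset ι) (f : ι → ℚ[X])
    (hf : ∀ i ∈ s, IntAt ν x (f i)) : IntAt ν x (∏ i ∈ s, f i) := by
  classical
  induction s using Finset.induction_on with
  | empty => simpa using IntAt.one
  | insert a s ha ih =>
    rw [Finset.prod_insert ha]
    exact (hf _ (by simp)).mul (ih fun i hi => hf i (by simp [hi]))

lemma IntAt_lin {ν j : ℕ} (hj : j ∣ ν) (k : ℤ) (c : ℚ) (hc : c * k = 1 ∨ k = 0)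
    (hc' : c * j = 1) : 
    IntAt ν 0 (C c * (X - C (k : ℚ))) := by
  obtain ⟨r, rfl⟩ := hj
  unfold IntAt
  have hck : ∃ e : ℤ, c * k = e := by
    rcases hc with h | h
    · exact ⟨1, by simp [h]⟩
    · exact ⟨0, by simp [h]⟩
  obtain ⟨e, he⟩ := hck
  refine ⟨C (r : ℤ) * X - C e, ?_⟩
  have : C c * C ((k : ℚ)) = C (e : ℚ) := by rw [← C_mul, he]
  have h2 : C c * C (j : ℚ) = 1 := by rw [← C_mul, hc', C_1]
  simp only [mapRingHom, RingHom.coe_mk, MonoidHom.coe_mk, OneHom.coe_mk, Polynomial.map_sub, Polynomial.map_mul, map_C,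
    Int.coe_castRingHom, map_X, mul_comp, sub_comp, C_comp, X_comp, Nat.cast_mul, C_mul,
    Nat.cast_zero, C_0, add_zero, mul_sub, this]
  simp only [← mul_assoc, h2, one_mul]
  simp

lemma Bp_succ_eq (a : ℕ) : Bp (a+1) = (C (((a+1 : ℕ) : ℚ)⁻¹) * (X - C ((0:ℤ) : ℚ))) *
    ∏ i ∈ Finset.range a, (C (((i+1 : ℕ) : ℚ)⁻¹) * (X - C (((i+1:ℕ):ℤ) : ℚ))) := by
  unfold Bp
  rw [Finset.prod_range_succ', Finset.prod_mul_distrib]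
  have : ∏ i ∈ Finset.range a, C (((i+1 : ℕ) : ℚ)⁻¹) = C ((a.factorial : ℚ)⁻¹) := by
    rw [← map_prod]
    congr 1
    rw [Finset.prod_inv_distrib, ← Finset.prod_range_add_one_eq_factorial]
    push_cast
    rfl
  rw [this, Nat.factorial_succ, Nat.cast_mul, mul_inv, C_mul]
  push_cast
  simp
  ring

lemma IntAt_Bp_zero {ν h : ℕ} (hν : ∀ j, 1 ≤ j → j ≤ h → j ∣ ν) (a : ℕ) (ha : a ≤ h) :
    IntAt ν 0 (Bp a) := by
  cases a with
  | zero => rw [Bp_zero]; exact IntAt.one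
  | succ a =>
    rw [Bp_succ_eq]
    apply IntAt.mul
    · apply IntAt_lin (hν (a+1) (by omega) ha) 0 _ (Or.inr rfl)
      have : ((a+1:ℕ):ℚ) ≠ 0 := by positivity
      field_simp
    · apply IntAt.prod
      intro i hi
      rw [Finset.mem_range] at hi
      have : ((i+1:ℕ):ℚ) ≠ 0 := by positivity
      apply IntAt_lin (hν (i+1) (by omega) (by omega)) _
      · left
        push_cast at *
        field_simp
      · field_simp

lemma IntAt_succ {ν x : ℕ} {f : ℚ[X]} (hf : IntAt ν x (f.comp (X + 1))) : IntAt ν (x+1) f := by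
  unfold IntAt at *
  rw [comp_assoc] at hf
  have : (X + 1 : ℚ[X]).comp (C (ν : ℚ) * X + C (x : ℚ)) = C (ν : ℚ) * X + C ((x + 1 : ℕ) : ℚ) := by
    simp [add_assoc]
  rwa [this] at hf

lemma IntAt_Bp {ν h : ℕ} (hν : ∀ j, 1 ≤ j → j ≤ h → j ∣ ν) (x : ℕ) : ∀ (a : ℕ) (_ : a ≤ h),
    IntAt ν x (Bp a) := by
  induction x with
  | zero => exact IntAt_Bp_zero hν
  | succ x ih =>
    intro a ha
    cases a with
    | zero => rw [Bp_zero]; exact IntAt.one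
    | succ a =>
      apply IntAt_succ
      rw [Bp_pascal]
      exact (ih _ ha).add (ih _ (by omega))

lemma IntAt.coeff {ν x : ℕ} {f : ℚ[X]} (hf : IntAt ν x f) (m : ℕ) :
    ∃ k : ℤ, (k : ℚ) = (ν : ℚ) ^ m * (hasseDeriv m f).eval (x : ℚ) := by
  obtain ⟨g, hg⟩ := hf
  refine ⟨g.coeff m, ?_⟩
  have h1 : f.comp (C (ν : ℚ) * X + C (x : ℚ)) = (taylor (x:ℚ) f).comp (C (ν : ℚ) * X) := by
    rw [taylor_apply, comp_assoc]
    simp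
  have h2 : (f.comp (C (ν : ℚ) * X + C (x : ℚ))).coeff m = (ν : ℚ) ^ m * (hasseDeriv m f).eval (x : ℚ) := by
    rw [h1, comp_C_mul_X_coeff, taylor_coeff, mul_comm]
  rw [← h2, ← hg]
  simp

lemma Qp_int {ν h : ℕ} (hν : ∀ j, 1 ≤ j → j ≤ h → j ∣ ν) (x a b m : ℕ) (ha : a ≤ h) :
    ∃ k : ℤ, (k : ℚ) = (ν : ℚ) ^ m * (hasseDeriv m (Qp h a b)).eval (x : ℚ) :=
  ((IntAt_Bp hν x a ha).mul ((IntAt_Bp hν x h le_rfl).pow b)).coeff m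

lemma Bp_natDegree (a : ℕ) : (Bp a).natDegree = a ∧ Bp a ≠ 0 := by
  have h1 : (∏ i ∈ Finset.range a, (X - C (i : ℚ))).Monic := monic_prod_of_monic _ _ fun i _ => monic_X_sub_C _
  have h2 : (a.factorial : ℚ)⁻¹ ≠ 0 := by positivity
  unfold Bp
  constructor
  · rw [natDegree_C_mul h2, natDegree_prod_of_monic _ _ fun i _ => monic_X_sub_C _]
    simp only [natDegree_X_sub_C]
    simp
  · exact mul_ne_zero (C_ne_zero.2 h2) h1.ne_zero

lemma Qp_natDegree (h a b : ℕ) : (Qp h a b).natDegree = a + h * b ∧ Qp h a b ≠ 0 := by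
  unfold Qp
  have h1 := (Bp_natDegree a)
  have h2 := (Bp_natDegree h)
  constructor
  · rw [natDegree_mul h1.2 (pow_ne_zero _ h2.2), natDegree_pow, h1.1, h2.1, mul_comm]
  · exact mul_ne_zero h1.2 (pow_ne_zero _ h2.2)

/-- linear independence of the `Qp`. -/
lemma Qp_indep (h K : ℕ) (c : Fin h × Fin K → ℚ)
    (hc : ∑ i, C (c i) * Qp h i.1 i.2 = 0) : c = 0 := by
  have hdeg : ∀ i, c i ≠ 0 → (C (c i) * Qp h i.1 i.2).degree = ((i.1 + h * i.2 : ℕ) : WithBot ℕ) := by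
    intro i hi
    rw [degree_C_mul hi, degree_eq_natDegree (Qp_natDegree _ _ _).2, (Qp_natDegree _ _ _).1]
  have h1 := Polynomial.degree_sum_eq_of_disjoint (fun i : Fin h × Fin K => C (c i) * Qp h i.1 i.2) Finset.univ (by
    rintro i ⟨_, hi⟩ j ⟨_, hj⟩ hij heq
    have hi' : c i ≠ 0 := fun h0 => hi (by simp [h0])
    have hj' : c j ≠ 0 := fun h0 => hj (by simp [h0])
    simp only [Function.comp] at heq
    rw [hdeg i hi', hdeg j hj'] at heq
    have heq' : (i.1 + h * i.2 : ℕ) = j.1 + h * j.2 := by exact_mod_cast heq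
    have e1 : (i.1 : ℕ) = j.1 := by
      have := congrArg (· % h) heq'
      simpa [Nat.add_mul_mod_self_left, Nat.mod_eq_of_lt] using this
    rw [e1] at heq'
    have hpos : 0 < h := lt_of_le_of_lt (Nat.zero_le _) i.1.2
    have e2 : (i.2 : ℕ) = j.2 := Nat.eq_of_mul_eq_mul_left hpos (by omega)
    exact hij (Prod.ext (Fin.ext e1) (Fin.ext e2)))
  rw [hc, degree_zero] at h1
  ext i
  by_contra hi
  have h2 : (C (c i) * Qp h i.1 i.2).degree ≤ ⊥ := by
    rw [h1]
    exact Finset.le_sup (f := fun i : Fin h × Fin K => (C (c i) * Qp h i.1 i.2).degree) (Finset.mem_univ i)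
  rw [le_bot_iff, degree_eq_bot] at h2
  exact (mul_ne_zero (C_ne_zero.2 hi) (Qp_natDegree _ _ _).2) h2

lemma Bp_eval_bound (h a : ℕ) (hh : 0 < h) (ha : a ≤ h) (ρ : ℝ) (hρ : 0 ≤ ρ) (w : ℂ) (hw : ‖w‖ ≤ ρ) :
    ‖((Bp a).map (algebraMap ℚ ℂ)).eval w‖ ≤ (Real.exp 1 * ((ρ + h) / h)) ^ h := by
  have h0 : (0:ℝ) < h := by exact_mod_cast hh
  have h1 : ‖((Bp a).map (algebraMap ℚ ℂ)).eval w‖ ≤ (ρ + h)^a / a.factorial := by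
    unfold Bp
    rw [Polynomial.map_mul, eval_mul, Polynomial.map_prod, eval_prod, norm_mul, norm_prod, mul_comm, div_eq_mul_inv]
    apply mul_le_mul
    · calc _ ≤ ∏ i ∈ Finset.range a, (ρ + h) := by
            apply Finset.prod_le_prod
            · intros; positivity
            · intro i hi
              rw [Finset.mem_range] at hi
              simp
              calc ‖w - i‖ ≤ ‖w‖ + ‖(i:ℂ)‖ := norm_sub_le _ _
                _ ≤ ρ + h := by
                  gcongr
                  simp
                  omega
        _ = _ := by simp
    · simp
    · positivity
    · positivity
  refine h1.trans ?_
  have h2 : ρ + h = ((ρ + h)/h) * h := by field_simp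
  have h3 : 1 ≤ (ρ+h)/h := by rw [le_div_iff₀ h0]; linarith
  rw [h2, mul_pow, mul_pow, mul_div_assoc, mul_comm]
  rw [← h2, ← Real.exp_nat_mul, mul_one]
  gcongr
  exact Real.pow_div_factorial_le_exp _ h0.le _

lemma Qp_eval_bound (h a b : ℕ) (hh : 0 < h) (ha : a ≤ h) (ρ : ℝ) (hρ : 0 ≤ ρ) (w : ℂ) (hw : ‖w‖ ≤ ρ) :
    ‖((Qp h a b).map (algebraMap ℚ ℂ)).eval w‖ ≤ (Real.exp 1 * ((ρ + h) / h)) ^ (h * (b+1)) := by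
  unfold Qp
  rw [Polynomial.map_mul, eval_mul, Polynomial.map_pow, eval_pow, norm_mul, norm_pow, pow_mul, pow_succ' _ b]
  gcongr
  · exact Bp_eval_bound h a hh ha ρ hρ w hw
  · exact Bp_eval_bound h h hh le_rfl ρ hρ w hw

lemma hasse_bound (P : ℂ[X]) (z : ℂ) (M : ℝ) (hM : ∀ w, ‖w - z‖ ≤ 1 → ‖P.eval w‖ ≤ M) (m : ℕ) :
    ‖(hasseDeriv m P).eval z‖ ≤ M := by
  have h1 : iteratedDeriv m (fun w => P.eval w) = fun z => (derivative^[m] P).eval z := by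
    induction m with
    | zero => simp
    | succ m ih =>
      rw [iteratedDeriv_succ, ih, Function.iterate_succ_apply']
      ext z
      simp
  have h2 := Complex.norm_iteratedDeriv_le_of_forall_mem_sphere_norm_le (n := m) (c := z) (R := 1) (C := M) (f := fun w => P.eval w)
    one_pos (P.differentiable.diffContOnCl) (by
      intro w hw
      apply hM
      rw [mem_sphere_iff_norm] at hw
      exact hw.le)
  rw [h1] at h2
  rw [← factorial_smul_hasseDeriv] at h2
  simp at h2
  have : (0:ℝ) < m.factorial := by positivity
  exact le_of_mul_le_mul_left h2 this

lemma Qp_hasse_bound (h a b m : ℕ) (hh : 0 < h) (ha : a ≤ h) (ρ : ℝ) (hρ : 0 ≤ ρ) (w : ℂ) (hw : ‖w‖ ≤ ρ) :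
    ‖(hasseDeriv m ((Qp h a b).map (algebraMap ℚ ℂ))).eval w‖ ≤ (Real.exp 1 * ((ρ + 1 + h) / h)) ^ (h * (b+1)) := by
  apply hasse_bound
  intro z hz
  apply Qp_eval_bound h a b hh ha (ρ+1) (by linarith)
  have := norm_le_norm_add_norm_sub w z
  rw [norm_sub_rev] at hz
  linarith

lemma nu_exists (h : ℕ) : ∃ ν : ℕ, 0 < ν ∧ (∀ j, 1 ≤ j → j ≤ h → j ∣ ν) ∧ (ν : ℝ) ≤ Real.exp (6 * h) := by
  refine ⟨Nat.lcmUpto h, Nat.lcmUpto_pos h, ?_, ?_⟩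
  · intro j h1 h2
    exact Finset.dvd_lcm (f := id) (Finset.mem_Icc.2 ⟨h1, h2⟩)
  · have h1 := Chebyshev.psi_eq_log_lcmUpto h
    have h2 := Chebyshev.psi_le_const_mul_self (x := h) (by positivity)
    rw [← Real.exp_log (show (0:ℝ) < Nat.lcmUpto h from by exact_mod_cast Nat.lcmUpto_pos h), ← h1]
    gcongr
    refine h2.trans ?_
    gcongr
    have : Real.log 4 = 2 * Real.log 2 := by
      rw [show (4:ℝ) = 2^2 by norm_num, Real.log_pow]; norm_num
    have := Real.log_two_lt_d9
    linarith

open Polynomial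

lemma trace_zero_of_irr (K : IntermediateField ℚ ℝ) [FiniteDimensional ℚ K] (x : K) (a : ℚ)
    (hx : (x : ℝ) ^ 5 = a) (hirr : ∀ c : ℚ, (x : ℝ) ≠ c) : Algebra.trace ℚ K x = 0 := by
  have ha : ∀ b : ℚ, b ^ 5 ≠ a := by
    intro b hb
    apply hirr b
    have : (x : ℝ) ^ 5 = (b : ℝ) ^ 5 := by rw [hx, ← hb]; push_cast; rfl
    have hodd : Odd 5 := by decide
    exact hodd.strictMono_pow.injective this
  have hirrP := X_pow_sub_C_irreducible_of_prime (by norm_num : Nat.Prime 5) ha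
  have hxK : x ^ 5 = algebraMap ℚ K a := by
    apply Subtype.ext
    push_cast
    rw [hx]; rfl
  have hmin : X ^ 5 - C a = minpoly ℚ x := by
    apply minpoly.eq_of_irreducible_of_monic hirrP
    · simp [hxK]
    · exact monic_X_pow_sub_C a (by norm_num)
  rw [trace_eq_finrank_mul_minpoly_nextCoeff, ← hmin]
  have : (X ^ 5 - C a : ℚ[X]).nextCoeff = 0 := by
    rw [nextCoeff_of_natDegree_pos (by rw [natDegree_X_pow_sub_C]; norm_num), natDegree_X_pow_sub_C]
    simp [coeff_X_pow]
  rw [this]; simp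

/-- the field `ℚ(ρ₁, ρ₂)` -/
noncomputable abbrev KK (ρ₁ ρ₂ : ℝ) : IntermediateField ℚ ℝ :=
  IntermediateField.adjoin ℚ {ρ₁} ⊔ IntermediateField.adjoin ℚ {ρ₂}

lemma rho_integral (ρ : ℝ) (a : ℚ) (h : ρ ^ 5 = a) : IsIntegral ℚ ρ :=
  ⟨X ^ 5 - C a, monic_X_pow_sub_C a (by norm_num), by simp [h]⟩

lemma rho_finrank (ρ : ℝ) (a : ℚ) (h : ρ ^ 5 = a) :
    Module.finrank ℚ (IntermediateField.adjoin ℚ {ρ}) ≤ 5 := by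
  rw [IntermediateField.adjoin.finrank (rho_integral ρ a h)]
  have h0 : (X ^ 5 - C a : ℚ[X]) ≠ 0 := X_pow_sub_C_ne_zero (by norm_num) a
  have := natDegree_le_of_dvd (minpoly.dvd ℚ ρ (p := X ^ 5 - C a) (by simp [h])) h0
  rwa [natDegree_X_pow_sub_C] at this

lemma KK_fin (ρ₁ ρ₂ : ℝ) (a₁ a₂ : ℚ) (h₁ : ρ₁ ^ 5 = a₁) (h₂ : ρ₂ ^ 5 = a₂) :
    FiniteDimensional ℚ (KK ρ₁ ρ₂) ∧ Module.finrank ℚ (KK ρ₁ ρ₂) ≤ 25 := by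
  have := IntermediateField.adjoin.finiteDimensional (rho_integral ρ₁ a₁ h₁)
  have := IntermediateField.adjoin.finiteDimensional (rho_integral ρ₂ a₂ h₂)
  refine ⟨IntermediateField.finiteDimensional_sup _ _, ?_⟩
  refine (IntermediateField.finrank_sup_le _ _).trans ?_
  exact Nat.mul_le_mul (rho_finrank _ _ h₁) (rho_finrank _ _ h₂)

lemma mem_KK₁ (ρ₁ ρ₂ : ℝ) : ρ₁ ∈ KK ρ₁ ρ₂ :=
  (le_sup_left : IntermediateField.adjoin ℚ {ρ₁} ≤ KK ρ₁ ρ₂) (IntermediateField.mem_adjoin_simple_self ℚ ρ₁)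
lemma mem_KK₂ (ρ₁ ρ₂ : ℝ) : ρ₂ ∈ KK ρ₁ ρ₂ :=
  (le_sup_right : IntermediateField.adjoin ℚ {ρ₂} ≤ KK ρ₁ ρ₂) (IntermediateField.mem_adjoin_simple_self ℚ ρ₂)

/-- Separation of residue classes modulo 5. -/
lemma sep {ι : Type*} [Fintype ι] (ρ₁ ρ₂ : ℝ) (a₁ a₂ : ℚ) (h₁ : ρ₁ ^ 5 = a₁) (h₂ : ρ₂ ^ 5 = a₂)
    (hp₁ : 0 < ρ₁) (hp₂ : 0 < ρ₂)
    (hK : ∀ (i j : ℤ) (c : ℚ), ρ₁ ^ i * ρ₂ ^ j = c → 5 ∣ i ∧ 5 ∣ j)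
    (r : ι → ℚ) (e₁ e₂ : ι → ℕ) (hs : ∑ i, (r i : ℝ) * (ρ₁ ^ e₁ i * ρ₂ ^ e₂ i) = 0) (i₀ : ι) :
    ∑ i with (e₁ i % 5 = e₁ i₀ % 5 ∧ e₂ i % 5 = e₂ i₀ % 5),
      (r i : ℝ) * (ρ₁ ^ e₁ i * ρ₂ ^ e₂ i) = 0 := by
  classical
  obtain ⟨hfin, -⟩ := KK_fin ρ₁ ρ₂ a₁ a₂ h₁ h₂
  let R₁ : KK ρ₁ ρ₂ := ⟨ρ₁, mem_KK₁ _ _⟩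
  let R₂ : KK ρ₁ ρ₂ := ⟨ρ₂, mem_KK₂ _ _⟩
  let x : ι → KK ρ₁ ρ₂ := fun i => R₁ ^ ((e₁ i : ℤ) - e₁ i₀) * R₂ ^ ((e₂ i : ℤ) - e₂ i₀)
  have hx : ∀ i, (x i : ℝ) = ρ₁ ^ ((e₁ i : ℤ) - e₁ i₀) * ρ₂ ^ ((e₂ i : ℤ) - e₂ i₀) := by
    intro i; rfl
  have hx' : ∀ i, (x i : ℝ) * (ρ₁ ^ e₁ i₀ * ρ₂ ^ e₂ i₀) = ρ₁ ^ e₁ i * ρ₂ ^ e₂ i := by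
    intro i
    rw [hx, zpow_sub₀ hp₁.ne', zpow_sub₀ hp₂.ne']
    simp only [zpow_natCast]
    field_simp
  have hsum : ∑ i, r i • x i = 0 := by
    apply Subtype.ext
    have : ((∑ i, r i • x i : KK ρ₁ ρ₂) : ℝ) = ∑ i, (r i : ℝ) * (x i : ℝ) := by
      rw [IntermediateField.coe_sum]
      apply Finset.sum_congr rfl
      intro i _
      rw [IntermediateField.coe_smul, Rat.smul_def]
    rw [this]
    have hne : ρ₁ ^ e₁ i₀ * ρ₂ ^ e₂ i₀ ≠ 0 := by positivity
    apply mul_right_cancel₀ hne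
    rw [Finset.sum_mul]
    simp only [mul_assoc, hx', hs]
    simp
  let P : ι → Prop := fun i => (e₁ i % 5 = e₁ i₀ % 5 ∧ e₂ i % 5 = e₂ i₀ % 5)
  have hin : ∀ i, P i → ∃ c : ℚ, (x i : ℝ) = c := by
    intro i ⟨hi1, hi2⟩
    obtain ⟨u, hu⟩ : (5:ℤ) ∣ ((e₁ i : ℤ) - e₁ i₀) := by omega
    obtain ⟨v, hv⟩ : (5:ℤ) ∣ ((e₂ i : ℤ) - e₂ i₀) := by omega
    refine ⟨a₁ ^ u * a₂ ^ v, ?_⟩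
    rw [hx, hu, hv, zpow_mul, zpow_mul]
    push_cast
    rw [← h₁, ← h₂]
    norm_cast
  have hout : ∀ i, ¬ P i → Algebra.trace ℚ (KK ρ₁ ρ₂) (x i) = 0 := by
    intro i hi
    apply trace_zero_of_irr _ _ (a₁ ^ ((e₁ i : ℤ) - e₁ i₀) * a₂ ^ ((e₂ i : ℤ) - e₂ i₀))
    · rw [hx]
      push_cast
      rw [← h₁, ← h₂, mul_pow]
      rw [← zpow_natCast, ← zpow_natCast, ← zpow_mul, ← zpow_mul, ← zpow_natCast, ← zpow_natCast, ← zpow_mul, ← zpow_mul]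
      simp only [mul_comm]
    · intro c hc
      rw [hx] at hc
      have := hK _ _ c hc
      apply hi
      constructor <;> omega
  choose! c hc using hin
  have htr := congrArg (Algebra.trace ℚ (KK ρ₁ ρ₂)) hsum
  rw [map_sum, map_zero] at htr
  simp only [map_smul] at htr
  have hterm : ∀ i, r i • Algebra.trace ℚ (KK ρ₁ ρ₂) (x i) =
      if P i then r i * (Module.finrank ℚ (KK ρ₁ ρ₂) * c i) else 0 := by
    intro i
    split_ifs with hi
    · have : x i = algebraMap ℚ _ (c i) := by
        apply Subtype.ext; rw [hc i hi]; rfl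
      rw [this, Algebra.trace_algebraMap]; simp
    · rw [hout i hi]; simp
  simp only [hterm] at htr
  rw [← Finset.sum_filter] at htr
  have hd : (Module.finrank ℚ (KK ρ₁ ρ₂) : ℚ) ≠ 0 := by
    have := Module.finrank_pos (R := ℚ) (M := KK ρ₁ ρ₂); positivity
  have h3 : ∑ i with P i, r i * c i = 0 := by
    apply mul_left_cancel₀ hd
    rw [Finset.mul_sum, mul_zero, ← htr]
    apply Finset.sum_congr rfl; intros; ring
  have h4 : ∑ i with P i, (r i : ℝ) * (ρ₁ ^ e₁ i * ρ₂ ^ e₂ i) =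
      ((∑ i with P i, r i * c i : ℚ) : ℝ) * (ρ₁ ^ e₁ i₀ * ρ₂ ^ e₂ i₀) := by
    push_cast
    rw [Finset.sum_mul]
    apply Finset.sum_congr rfl
    intro i hi
    rw [Finset.mem_filter] at hi
    rw [← hx', hc i hi.2]; ring
  show ∑ i with P i, _ = _
  rw [h4, h3]; simp

/-- Liouville inequality. -/
lemma liouville5 {ι : Type*} [Fintype ι] (ρ₁ ρ₂ : ℝ) (p₁ q₁ p₂ q₂ : ℕ) (hq₁ : 0 < q₁) (hq₂ : 0 < q₂)
    (h₁ : ρ₁ ^ 5 = p₁ / q₁) (h₂ : ρ₂ ^ 5 = p₂ / q₂)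
    (hp₁ : 0 < ρ₁) (hp₂ : 0 < ρ₂) (A : ℝ) (hA1 : 1 ≤ A)
    (hA : p₁ ≤ A ∧ q₁ ≤ A ∧ p₂ ≤ A ∧ q₂ ≤ A)
    (c : ι → ℤ) (e₁ e₂ : ι → ℕ) (N : ℕ) (he : ∀ i, e₁ i ≤ N ∧ e₂ i ≤ N)
    (hV : ∑ i, (c i : ℝ) * (ρ₁ ^ e₁ i * ρ₂ ^ e₂ i) ≠ 0) :
    1 ≤ |∑ i, (c i : ℝ) * (ρ₁ ^ e₁ i * ρ₂ ^ e₂ i)| * ((∑ i, |(c i : ℝ)|) * A ^ (2 * N)) ^ 25 := by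
  classical
  obtain ⟨hA1', hA2, hA3, hA4⟩ := hA
  obtain ⟨hfin, hrank⟩ := KK_fin ρ₁ ρ₂ (p₁/q₁) (p₂/q₂) (by push_cast; exact h₁) (by push_cast; exact h₂)
  set K := KK ρ₁ ρ₂ with hKdef
  let R₁ : K := ⟨ρ₁, mem_KK₁ _ _⟩
  let R₂ : K := ⟨ρ₂, mem_KK₂ _ _⟩
  have hR₁ : R₁ ^ 5 * q₁ = p₁ := by
    apply Subtype.ext; push_cast; show ρ₁ ^ 5 * q₁ = p₁; rw [h₁]; field_simp
  have hR₂ : R₂ ^ 5 * q₂ = p₂ := by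
    apply Subtype.ext; push_cast; show ρ₂ ^ 5 * q₂ = p₂; rw [h₂]; field_simp
  have hisInt : ∀ (R : K) (p q : ℕ), R ^ 5 * q = p → IsIntegral ℤ ((q : K) * R) := by
    intro R p q h
    apply IsIntegral.of_pow (n := 5) (by norm_num)
    have : ((q : K) * R) ^ 5 = ((q ^ 4 * p : ℕ) : K) := by
      push_cast; rw [← h]; ring
    rw [this]
    have h2 := isIntegral_algebraMap (R := ℤ) (A := K) (x := ((q ^ 4 * p : ℕ) : ℤ))
    rwa [eq_intCast, Int.cast_natCast] at h2
  let W : K := ∑ i, (c i : K) * ((((q₁ : K) * R₁) ^ e₁ i * (q₁ : K) ^ (N - e₁ i)) *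
    (((q₂ : K) * R₂) ^ e₂ i * (q₂ : K) ^ (N - e₂ i)))
  have hWint : IsIntegral ℤ W := by
    apply IsIntegral.sum
    intro i _
    have hn : ∀ n : ℕ, IsIntegral ℤ (n : K) := fun n => by
      simpa using isIntegral_algebraMap (R := ℤ) (A := K) (x := (n : ℤ))
    have hz : ∀ n : ℤ, IsIntegral ℤ (n : K) := fun n => by
      simpa using isIntegral_algebraMap (R := ℤ) (A := K) (x := (n : ℤ))
    exact (hz _).mul ((((hisInt _ _ _ hR₁).pow _).mul ((hn _).pow _)).mul (((hisInt _ _ _ hR₂).pow _).mul ((hn _).pow _)))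
  set V := ∑ i, (c i : ℝ) * (ρ₁ ^ e₁ i * ρ₂ ^ e₂ i) with hVdef
  have hWV : (W : ℝ) = V * ((q₁ : ℝ) ^ N * (q₂ : ℝ) ^ N) := by
    have : (W : ℝ) = ∑ i, (c i : ℝ) * ((((q₁ : ℝ) * ρ₁) ^ e₁ i * (q₁ : ℝ) ^ (N - e₁ i)) *
        (((q₂ : ℝ) * ρ₂) ^ e₂ i * (q₂ : ℝ) ^ (N - e₂ i))) := by
      simp only [W, IntermediateField.coe_sum]
      apply Finset.sum_congr rfl
      intro i _
      push_cast
      rfl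
    rw [this, hVdef, Finset.sum_mul]
    apply Finset.sum_congr rfl
    intro i _
    have e1 : (q₁:ℝ)^N = (q₁:ℝ)^(e₁ i) * (q₁:ℝ)^(N - e₁ i) := by rw [← pow_add, Nat.add_sub_cancel' (he i).1]
    have e2 : (q₂:ℝ)^N = (q₂:ℝ)^(e₂ i) * (q₂:ℝ)^(N - e₂ i) := by rw [← pow_add, Nat.add_sub_cancel' (he i).2]
    rw [e1, e2, mul_pow, mul_pow]; ring
  have hq₁r : (1:ℝ) ≤ q₁ := by exact_mod_cast hq₁
  have hq₂r : (1:ℝ) ≤ q₂ := by exact_mod_cast hq₂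
  have hWne : W ≠ 0 := by
    intro h
    have : (W : ℝ) = 0 := by rw [h]; rfl
    rw [hWV] at this
    have : V = 0 := by
      rcases mul_eq_zero.1 this with h | h
      · exact h
      · exfalso; have : 0 < (q₁ : ℝ) ^ N * (q₂ : ℝ) ^ N := by positivity
        exact this.ne' h
    exact hV this
  -- norm is at least one
  have hnorm : (1:ℝ) ≤ ‖algebraMap ℚ ℂ (Algebra.norm ℚ W)‖ := by
    have hi : IsIntegral ℤ (Algebra.norm ℚ W) := Algebra.isIntegral_norm ℚ hWint
    obtain ⟨n, hn⟩ := IsIntegrallyClosed.isIntegral_iff.1 hi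
    have hn0 : n ≠ 0 := by
      rintro rfl
      rw [map_zero] at hn
      exact (Algebra.norm_ne_zero_iff.2 hWne) hn.symm
    rw [← hn]
    simp only [eq_intCast, Rat.cast_intCast, eq_ratCast]
    rw [Complex.norm_intCast]
    exact_mod_cast Int.one_le_abs hn0
  rw [Algebra.norm_eq_prod_embeddings ℚ ℂ W, norm_prod] at hnorm
  set Gc := ∑ i, |(c i : ℝ)| with hGc
  have hσ : ∀ (R : K) (p q : ℕ), R ^ 5 * q = p → (p:ℝ) ≤ A → (q:ℝ) ≤ A → ∀ σ : K →ₐ[ℚ] ℂ, ‖(q:ℂ) * σ R‖ ≤ A := by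
    intro R p q h hp hq σ
    have h5 : ((q:ℂ) * σ R) ^ 5 = (q:ℂ) ^ 4 * p := by
      have : σ (R ^ 5 * q) = σ p := by rw [h]
      rw [map_mul, map_pow, map_natCast, map_natCast] at this
      rw [← this]; ring
    have : ‖(q:ℂ) * σ R‖ ^ 5 ≤ A ^ 5 := by
      rw [← norm_pow, h5, norm_mul, norm_pow, Complex.norm_natCast, Complex.norm_natCast]
      calc (q:ℝ)^4 * p ≤ A ^ 4 * A := by gcongr
        _ = A ^ 5 := by ring
    exact le_of_pow_le_pow_left₀ (by norm_num) (by linarith) this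
  have hbound : ∀ σ : K →ₐ[ℚ] ℂ, ‖σ W‖ ≤ Gc * A ^ (2 * N) := by
    intro σ
    simp only [W, map_sum, map_mul, map_pow, map_intCast, map_natCast]
    rw [hGc, Finset.sum_mul]
    apply norm_sum_le_of_le
    intro i _
    rw [norm_mul, Complex.norm_intCast]
    apply mul_le_mul_of_nonneg_left _ (abs_nonneg _)
    rw [norm_mul, norm_mul, norm_mul, norm_pow, norm_pow, norm_pow, norm_pow, Complex.norm_natCast, Complex.norm_natCast]
    have b1 := hσ _ _ _ hR₁ hA1' hA2 σ
    have b2 := hσ _ _ _ hR₂ hA3 hA4 σ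
    calc _ ≤ (A ^ e₁ i * A ^ (N - e₁ i)) * (A ^ e₂ i * A ^ (N - e₂ i)) := by gcongr
      _ = A ^ (2 * N) := by
        rw [← pow_add, ← pow_add, ← pow_add]; congr 1
        have := he i; omega
  have hGc1 : 1 ≤ Gc := by
    have : ∃ i, c i ≠ 0 := by
      by_contra! h
      apply hV
      rw [hVdef]; simp [h]
    obtain ⟨i, hi⟩ := this
    calc (1:ℝ) ≤ |(c i : ℝ)| := by exact_mod_cast Int.one_le_abs hi
      _ ≤ Gc := Finset.single_le_sum (f := fun i => |(c i : ℝ)|) (fun i _ => abs_nonneg _) (Finset.mem_univ i)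
  have hG1 : 1 ≤ Gc * A ^ (2 * N) := one_le_mul_of_one_le_of_one_le hGc1 (one_le_pow₀ hA1)
  set G := Gc * A ^ (2 * N) with hG
  let σ₀ : K →ₐ[ℚ] ℂ := (Complex.ofRealAm.restrictScalars ℚ).comp K.val
  have hσ₀ : ‖σ₀ W‖ ≤ |V| * G := by
    have : σ₀ W = ((W : ℝ) : ℂ) := rfl
    rw [this, Complex.norm_real, Real.norm_eq_abs, hWV, abs_mul]
    apply mul_le_mul_of_nonneg_left _ (abs_nonneg _)
    rw [abs_of_nonneg (by positivity)]
    calc (q₁:ℝ)^N * (q₂:ℝ)^N ≤ A ^ N * A ^ N := by gcongr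
      _ = 1 * A ^ (2 * N) := by rw [← pow_add]; rw [one_mul]; congr 1; omega
      _ ≤ _ := by rw [hG]; gcongr
  have hcard : Fintype.card (K →ₐ[ℚ] ℂ) ≤ 25 := by
    rw [AlgHom.card]; exact hrank
  calc 1 ≤ ∏ σ : K →ₐ[ℚ] ℂ, ‖σ W‖ := hnorm
    _ = ‖σ₀ W‖ * ∏ σ ∈ Finset.univ.erase σ₀, ‖σ W‖ := (Finset.mul_prod_erase _ _ (Finset.mem_univ _)).symm
    _ ≤ (|V| * G) * ∏ σ ∈ Finset.univ.erase σ₀, G := by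
        gcongr
        · exact hbound _
    _ = |V| * (G * G ^ (Fintype.card (K →ₐ[ℚ] ℂ) - 1)) := by
        rw [Finset.prod_const, Finset.card_erase_of_mem (Finset.mem_univ _), Finset.card_univ]; ring
    _ ≤ |V| * G ^ 25 := by
        rw [← pow_succ']
        apply mul_le_mul_of_nonneg_left _ (abs_nonneg _)
        exact pow_le_pow_right₀ hG1 (by omega)

open Polynomial

/-- vanishing to order at least `n` -/
def VO (n : ℕ) (x : ℂ) (f : ℂ → ℂ) : Prop :=
  ∃ g, AnalyticAt ℂ g x ∧ ∀ᶠ z in nhds x, f z = (z - x) ^ n * g z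

lemma VO_iff {n : ℕ} {x : ℂ} {f : ℂ → ℂ} (hf : AnalyticAt ℂ f x) :
    VO n x f ↔ (n : ℕ∞) ≤ analyticOrderAt f x := by
  rw [natCast_le_analyticOrderAt hf]; rfl

lemma VO.add {n : ℕ} {x : ℂ} {f g : ℂ → ℂ} (hf : VO n x f) (hg : VO n x g) :
    VO n x (fun z => f z + g z) := by
  obtain ⟨F, hF, hF'⟩ := hf
  obtain ⟨G, hG, hG'⟩ := hg
  refine ⟨fun z => F z + G z, hF.add hG, ?_⟩
  filter_upwards [hF', hG'] with z h1 h2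
  rw [h1, h2]; ring

lemma VO.mul {n : ℕ} {x : ℂ} {f g : ℂ → ℂ} (hf : VO n x f) (hg : AnalyticAt ℂ g x) :
    VO n x (fun z => f z * g z) := by
  obtain ⟨F, hF, hF'⟩ := hf
  refine ⟨fun z => F z * g z, hF.mul hg, ?_⟩
  filter_upwards [hF'] with z h1
  rw [h1]; ring

lemma VO.mono {n m : ℕ} {x : ℂ} {f : ℂ → ℂ} (hf : VO n x f) (hm : m ≤ n) : VO m x f := by
  obtain ⟨F, hF, hF'⟩ := hf
  refine ⟨fun z => (z - x) ^ (n - m) * F z, by fun_prop, ?_⟩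
  filter_upwards [hF'] with z h1
  rw [h1, ← mul_assoc, ← pow_add, Nat.add_sub_cancel' hm]

lemma VO_step {n : ℕ} {x : ℂ} {f : ℂ → ℂ} (hf : AnalyticAt ℂ f x) (h0 : f x = 0)
    (hd : VO n x (deriv f)) : VO (n+1) x f := by
  rw [VO_iff hf]
  rw [VO_iff hf.deriv] at hd
  have := hf.analyticOrderAt_deriv_add_one
  rw [h0] at this
  simp only [sub_zero] at this
  rw [← this]
  push_cast
  gcongr

lemma VO_family (F : ℕ → ℕ → ℂ → ℂ) (G : ℕ → ℕ → ℂ → ℂ) (w : ℂ → ℂ) (c : ℕ → ℂ) (θ x : ℂ)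
    (hF : ∀ i j, Differentiable ℂ (F i j)) (hG : ∀ i j, Differentiable ℂ (G i j))
    (hd : ∀ i j z, deriv (F i j) z = c i * F (i+1) j z + θ * F i (j+1) z + w z * G i j z)
    (T n : ℕ) (hw : VO n x w) (h0 : ∀ i j, i < T → j < T → F i j x = 0) :
    ∀ k, k ≤ n → ∀ i j, i + k ≤ T → j + k ≤ T → VO k x (F i j) := by
  have han : ∀ i j, AnalyticAt ℂ (F i j) x := fun i j => (hF i j).analyticAt x
  have hanG : ∀ i j, AnalyticAt ℂ (G i j) x := fun i j => (hG i j).analyticAt x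
  intro k
  induction k with
  | zero => intro _ i j _ _; exact ⟨F i j, han i j, by simp⟩
  | succ k ih =>
    intro hk i j hi hj
    apply VO_step (han i j) (h0 i j (by omega) (by omega))
    have e : deriv (F i j) = fun z => (F (i+1) j z * c i + F i (j+1) z * θ) + w z * G i j z := by
      funext z; rw [hd]; ring
    rw [e]
    exact (((ih (by omega) (i+1) j (by omega) (by omega)).mul analyticAt_const).add
      ((ih (by omega) i (j+1) (by omega) (by omega)).mul analyticAt_const)).add
      ((hw.mono (by omega)).mul (hanG i j))

lemma entire_div {n : ℕ} {a : ℂ} {f : ℂ → ℂ} (hf : Differentiable ℂ f) (h : VO n a f) :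
    ∃ g, Differentiable ℂ g ∧ ∀ z, f z = (z - a) ^ n * g z := by
  classical
  obtain ⟨g, hg, hg'⟩ := h
  let G : ℂ → ℂ := fun z => if z = a then g a else f z / (z - a) ^ n
  refine ⟨G, ?_, ?_⟩
  · intro z
    by_cases hz : z = a
    · subst hz
      have : G =ᶠ[nhds z] g := by
        filter_upwards [hg'] with y hy
        by_cases hyz : y = z
        · simp [G, hyz]
        · have : (y - z) ^ n ≠ 0 := pow_ne_zero _ (sub_ne_zero.2 hyz)
          simp only [G, hyz, if_false, hy]
          field_simp
      exact hg.differentiableAt.congr_of_eventuallyEq this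
    · have : G =ᶠ[nhds z] fun y => f y / (y - a) ^ n := by
        filter_upwards [isOpen_ne.mem_nhds hz] with y hy
        have hy' : y ≠ a := hy
        simp [G, hy']
      refine DifferentiableAt.congr_of_eventuallyEq ?_ this
      apply (hf z).div (by fun_prop)
      exact pow_ne_zero _ (sub_ne_zero.2 hz)
  · intro z
    by_cases hz : z = a
    · subst hz
      have := hg'.self_of_nhds
      simp [G, this]
    · have : (z - a) ^ n ≠ 0 := pow_ne_zero _ (sub_ne_zero.2 hz)
      simp only [G, hz, if_false]
      field_simp

lemma VO_of_mul {n : ℕ} {a : ℂ} {f h : ℂ → ℂ} (hh : AnalyticAt ℂ h a) (hha : h a ≠ 0)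
    (hv : VO n a (fun z => h z * f z)) : VO n a f := by
  obtain ⟨F, hF, hF'⟩ := hv
  refine ⟨fun z => F z / h z, hF.div hh hha, ?_⟩
  filter_upwards [hF', hh.continuousAt.eventually_ne hha] with z h1 h2
  rw [mul_div_assoc', eq_div_iff h2, ← h1]; ring

lemma entire_factor {f : ℂ → ℂ} (hf : Differentiable ℂ f) (n S : ℕ)
    (h : ∀ x < S, VO n (x : ℂ) f) :
    ∃ g, Differentiable ℂ g ∧ ∀ z, f z = (∏ x ∈ Finset.range S, (z - x) ^ n) * g z := by
  induction S with
  | zero => exact ⟨f, hf, by simp⟩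
  | succ S ih =>
    obtain ⟨g, hg, hfg⟩ := ih fun x hx => h x (by omega)
    have h1 : VO n (S : ℂ) g := by
      apply VO_of_mul (h := fun z => ∏ x ∈ Finset.range S, (z - x) ^ n)
      · apply Differentiable.analyticAt
        fun_prop
      · rw [Finset.prod_ne_zero_iff]
        intro x hx
        rw [Finset.mem_range] at hx
        apply pow_ne_zero
        rw [sub_ne_zero]
        exact_mod_cast hx.ne'
      · have := h S (by omega)
        have e : f = fun z : ℂ => (∏ x ∈ Finset.range S, (z - x) ^ n) * g z := funext hfg
        rwa [e] at this
    obtain ⟨g', hg', hgg'⟩ := entire_div hg h1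
    refine ⟨g', hg', fun z => ?_⟩
    rw [hfg, hgg', Finset.prod_range_succ]; ring

lemma schwarz {f : ℂ → ℂ} (hf : Differentiable ℂ f) (n S : ℕ)
    (h : ∀ x < S, VO n (x : ℂ) f) (R M : ℝ) (hR : (S : ℝ) < R)
    (hM : ∀ z, ‖z‖ ≤ R → ‖f z‖ ≤ M) (z₀ : ℝ) (hz0 : 0 ≤ z₀) (hz1 : z₀ ≤ S) :
    ‖f z₀‖ ≤ M * (S / (R - S)) ^ (n * S) := by
  obtain ⟨g, hg, hfg⟩ := entire_factor hf n S h
  have hSR : 0 < R - S := by linarith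
  have hR0 : 0 < R := lt_of_le_of_lt (Nat.cast_nonneg S) hR
  have hgb : ‖g z₀‖ ≤ M / (R - S) ^ (n * S) := by
    apply Complex.norm_le_of_forall_mem_frontier_norm_le (U := Metric.ball (0:ℂ) R) Metric.isBounded_ball
      hg.diffContOnCl
    · intro z hz
      rw [frontier_ball _ hR0.ne'] at hz
      have hz' : ‖z‖ = R := by simpa using hz
      rw [le_div_iff₀ (by positivity)]
      refine le_trans ?_ (hM z hz'.le)
      rw [hfg, norm_mul, mul_comm, norm_prod]
      apply mul_le_mul_of_nonneg_right _ (norm_nonneg _)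
      calc (R - S) ^ (n * S) = ∏ x ∈ Finset.range S, (R - S) ^ n := by
            rw [Finset.prod_const, Finset.card_range, pow_mul]
        _ ≤ _ := by
            apply Finset.prod_le_prod
            · intros; positivity
            · intro x hx
              rw [norm_pow]
              have hx' : (x : ℝ) ≤ S := by exact_mod_cast (Finset.mem_range.1 hx).le
              have : R - S ≤ ‖z - x‖ := by
                have := norm_sub_norm_le z (x:ℂ)
                rw [Complex.norm_natCast, hz'] at this
                linarith
              gcongr
    · rw [closure_ball _ hR0.ne', mem_closedBall_zero_iff, Complex.norm_real, Real.norm_eq_abs, abs_of_nonneg hz0]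
      linarith
  rw [hfg, norm_mul, norm_prod]
  have hP : ∏ x ∈ Finset.range S, ‖((z₀:ℂ) - x) ^ n‖ ≤ (S:ℝ) ^ (n * S) := by
    calc _ ≤ ∏ x ∈ Finset.range S, (S:ℝ) ^ n := by
            apply Finset.prod_le_prod
            · intros; positivity
            · intro x hx
              rw [norm_pow]
              have hx' : (x : ℝ) ≤ S := by exact_mod_cast (Finset.mem_range.1 hx).le
              have : ‖(z₀:ℂ) - x‖ ≤ S := by
                have : (z₀:ℂ) - x = ((z₀ - x : ℝ) : ℂ) := by push_cast; rfl
                rw [this, Complex.norm_real, Real.norm_eq_abs, abs_le]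
                constructor <;> linarith [Nat.cast_nonneg (α := ℝ) x]
              gcongr
      _ = _ := by rw [Finset.prod_const, Finset.card_range, pow_mul]
  calc _ ≤ (S:ℝ) ^ (n * S) * (M / (R - S) ^ (n * S)) := by gcongr
    _ = _ := by rw [div_pow]; ring

/-- the entire function `u` with `u(x) = x` at integers and derivative vanishing to order `n`. -/
noncomputable def uu (n : ℕ) (z : ℂ) : ℂ :=
  z + ∑ k ∈ Finset.range n, ((n.choose (k+1) : ℂ) * (-1) ^ (k+1)) *
    ((Complex.exp (2 * Real.pi * Complex.I * (k+1) * z) - 1) / (2 * Real.pi * Complex.I * (k+1)))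

lemma uu_nat (n x : ℕ) : uu n x = x := by
  unfold uu
  have : ∀ k ∈ Finset.range n, ((n.choose (k+1) : ℂ) * (-1) ^ (k+1)) *
    ((Complex.exp (2 * Real.pi * Complex.I * (k+1) * x) - 1) / (2 * Real.pi * Complex.I * (k+1))) = 0 := by
    intro k _
    have : Complex.exp (2 * Real.pi * Complex.I * (k+1) * x) = 1 := by
      rw [Complex.exp_eq_one_iff]
      refine ⟨(k+1) * x, ?_⟩
      push_cast; ring
    rw [this]; simp
  rw [Finset.sum_eq_zero this]; simp

lemma uu_deriv (n : ℕ) (z : ℂ) :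
    HasDerivAt (uu n) ((1 - Complex.exp (2 * Real.pi * Complex.I * z)) ^ n) z := by
  have hpi : (Real.pi : ℂ) ≠ 0 := by exact_mod_cast Real.pi_ne_zero
  have h1 : ∀ k : ℕ, HasDerivAt (fun z => ((n.choose (k+1) : ℂ) * (-1) ^ (k+1)) *
    ((Complex.exp (2 * Real.pi * Complex.I * (k+1) * z) - 1) / (2 * Real.pi * Complex.I * (k+1))))
     (((n.choose (k+1) : ℂ) * (-1) ^ (k+1)) * Complex.exp (2 * Real.pi * Complex.I * z) ^ (k+1)) z := by
    intro k
    have hk : ((k:ℂ) + 1) ≠ 0 := by exact_mod_cast Nat.succ_ne_zero k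
    have h2 : HasDerivAt (fun z : ℂ => 2 * Real.pi * Complex.I * (k+1) * z) (2 * Real.pi * Complex.I * (k+1)) z := by
      simpa using (hasDerivAt_id z).const_mul (2 * Real.pi * Complex.I * (k+1))
    have h3 := ((h2.cexp.sub_const 1).div_const (2 * Real.pi * Complex.I * (k+1))).const_mul
      ((n.choose (k+1) : ℂ) * (-1) ^ (k+1))
    refine h3.congr_deriv ?_
    rw [mul_div_assoc (Complex.exp _), div_self (by simp [hpi, hk]), mul_one, ← Complex.exp_nat_mul (2 * Real.pi * Complex.I * z)]
    congr 2
    push_cast; ring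
  have h4 := (hasDerivAt_id z).add (HasDerivAt.fun_sum (u := Finset.range n) fun k _ => h1 k)
  have e : (1 - Complex.exp (2 * Real.pi * Complex.I * z)) ^ n = 1 + ∑ k ∈ Finset.range n,
      (((n.choose (k+1) : ℂ) * (-1) ^ (k+1)) * Complex.exp (2 * Real.pi * Complex.I * z) ^ (k+1)) := by
    rw [sub_eq_add_neg, add_comm, add_pow, Finset.sum_range_succ', add_comm]
    congr 1
    · simp
    · apply Finset.sum_congr rfl
      intro k _
      rw [neg_pow]; simp; ring
  rw [e]
  exact h4

lemma uu_VO (n x : ℕ) : VO n (x : ℂ) (fun z => (1 - Complex.exp (2 * Real.pi * Complex.I * z)) ^ n) := by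
  have h1 : VO 1 (x : ℂ) (fun z => (1 - Complex.exp (2 * Real.pi * Complex.I * z))) := by
    have han : AnalyticAt ℂ (fun z => (1 - Complex.exp (2 * Real.pi * Complex.I * z))) (x : ℂ) := by
      apply Differentiable.analyticAt; fun_prop
    rw [VO_iff han]
    have : analyticOrderAt (fun z => (1 - Complex.exp (2 * Real.pi * Complex.I * z))) (x:ℂ) ≠ 0 := by
      rw [han.analyticOrderAt_ne_zero]
      have : Complex.exp (2 * Real.pi * Complex.I * x) = 1 := by
        rw [Complex.exp_eq_one_iff]
        refine ⟨x, ?_⟩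
        push_cast; ring
      rw [this]; simp
    exact_mod_cast Order.one_le_iff_pos.2 (pos_iff_ne_zero.2 this)
  obtain ⟨g, hg, hg'⟩ := h1
  refine ⟨fun z => g z ^ n, hg.pow n, ?_⟩
  filter_upwards [hg'] with z hz
  rw [hz, pow_one, mul_pow]

lemma uu_bound (n : ℕ) (R : ℝ) (hR : 0 ≤ R) (z : ℂ) (hz : ‖z‖ ≤ R) :
    ‖uu n z‖ ≤ R + 2 ^ n * Real.exp (7 * R * n) := by
  unfold uu
  refine (norm_add_le _ _).trans ?_
  gcongr
  have hpi := Real.pi_gt_three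
  have hpi' := Real.pi_lt_d2
  calc _ ≤ ∑ k ∈ Finset.range n, (n.choose (k+1) : ℝ) * Real.exp (7 * R * n) := by
        apply norm_sum_le_of_le
        intro k hk
        rw [Finset.mem_range] at hk
        have hk' : (k:ℝ) + 1 ≤ n := by exact_mod_cast hk
        rw [norm_mul, norm_mul, norm_pow, norm_neg, norm_one, one_pow, mul_one, Complex.norm_natCast]
        apply mul_le_mul_of_nonneg_left _ (by positivity)
        rw [norm_div]
        have hden : 6 ≤ ‖2 * (Real.pi:ℂ) * Complex.I * (k+1)‖ := by
          have : ‖2 * (Real.pi:ℂ) * Complex.I * (k+1)‖ = 2 * Real.pi * (k+1) := by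
            rw [norm_mul, norm_mul, norm_mul, Complex.norm_I, Complex.norm_real, Real.norm_eq_abs, abs_of_pos Real.pi_pos]
            have : ‖(k:ℂ)+1‖ = k + 1 := by exact_mod_cast Complex.norm_natCast (k+1)
            rw [this]; simp
          rw [this]
          have : (0:ℝ) ≤ k := Nat.cast_nonneg k
          nlinarith
        have hnum : ‖Complex.exp (2 * Real.pi * Complex.I * (k+1) * z) - 1‖ ≤ 2 * Real.exp (7 * R * n) := by
          refine (norm_sub_le _ _).trans ?_
          rw [norm_one, Complex.norm_exp]
          have h1 : (2 * Real.pi * Complex.I * (k+1) * z).re ≤ 7 * R * n := by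
            refine (Complex.re_le_norm _).trans ?_
            rw [norm_mul]
            have : ‖2 * (Real.pi:ℂ) * Complex.I * (k+1)‖ = 2 * Real.pi * (k+1) := by
              rw [norm_mul, norm_mul, norm_mul, Complex.norm_I, Complex.norm_real, Real.norm_eq_abs, abs_of_pos Real.pi_pos]
              have : ‖(k:ℂ)+1‖ = k + 1 := by exact_mod_cast Complex.norm_natCast (k+1)
              rw [this]; simp
            rw [this]
            calc 2 * Real.pi * (k+1) * ‖z‖ ≤ 7 * n * R := by
                  gcongr
                  linarith
              _ = _ := by ring
          have h2 : 1 ≤ Real.exp (7 * R * n) := Real.one_le_exp (by positivity)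
          have h3 := Real.exp_le_exp.2 h1
          linarith
        rw [div_le_iff₀ (by linarith)]
        have : 0 < Real.exp (7 * R * n) := Real.exp_pos _
        nlinarith
    _ ≤ _ := by
        rw [← Finset.sum_mul]
        gcongr
        have : (∑ m ∈ Finset.range (n+1), (n.choose m : ℝ)) = 2 ^ n := by exact_mod_cast Nat.sum_range_choose n
        rw [Finset.sum_range_succ'] at this
        rw [← this]
        simp

open Polynomial

lemma siegel_wrap {α β : Type*} [Fintype α] [Fintype β] (A : α → β → ℤ) (B : ℝ) (hB : 1 ≤ B)
    (hA : ∀ i j, |(A i j : ℝ)| ≤ B) (hc : 2 * Fintype.card α ≤ Fintype.card β)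
    (h0 : 0 < Fintype.card α) :
    ∃ t : β → ℤ, t ≠ 0 ∧ (∀ i, ∑ j, A i j * t j = 0) ∧ ∀ j, |(t j : ℝ)| ≤ Fintype.card β * B := by
  obtain ⟨t, ht0, ht, hb⟩ := Int.Matrix.exists_ne_zero_int_vec_norm_le (Matrix.of A) (by omega) h0
  refine ⟨t, ht0, fun i => congrFun ht i, fun j => ?_⟩
  let _ := @Matrix.seminormedAddCommGroup α β ℤ _ _ _
  have hn : ‖Matrix.of A‖ ≤ B := by
    rw [Matrix.norm_le_iff (by linarith)]
    intro i j
    rw [Int.norm_eq_abs]; exact hA i j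
  have h1 : |(t j : ℝ)| ≤ ‖t‖ := by
    rw [← Int.norm_eq_abs]; exact norm_le_pi_norm t j
  refine h1.trans (hb.trans ?_)
  have hcβ : (1:ℝ) ≤ Fintype.card β := by
    have : 1 ≤ Fintype.card β := by omega
    exact_mod_cast this
  have hc' : 2 * (Fintype.card α : ℝ) ≤ Fintype.card β := by exact_mod_cast hc
  have h0' : (0 : ℝ) < Fintype.card α := by exact_mod_cast h0
  have hbase : 1 ≤ (Fintype.card β : ℝ) * max 1 ‖Matrix.of A‖ :=
    one_le_mul_of_one_le_of_one_le hcβ (le_max_left _ _)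
  calc _ ≤ ((Fintype.card β : ℝ) * max 1 ‖Matrix.of A‖) ^ (1:ℝ) := by
        apply Real.rpow_le_rpow_of_exponent_le hbase
        rw [div_le_one (by linarith)]; linarith
    _ ≤ _ := by
        rw [Real.rpow_one]
        gcongr
        exact max_le hB hn

lemma hasse_map_aux (m : ℕ) (P : ℚ[X]) :
    hasseDeriv m (P.map (algebraMap ℚ ℂ)) = (hasseDeriv m P).map (algebraMap ℚ ℂ) := by
  ext n
  simp [hasseDeriv_coeff, coeff_map]

/-- The data for the main transcendence argument. -/
structure Dat where
  p₁ : ℕ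
  q₁ : ℕ
  p₂ : ℕ
  q₂ : ℕ
  hp₁ : 0 < p₁
  hq₁ : 0 < q₁
  hp₂ : 0 < p₂
  hq₂ : 0 < q₂
  s : ℝ
  hs : 1 ≤ s
  hp₁' : (p₁ : ℝ) ≤ Real.exp s
  hq₁' : (q₁ : ℝ) ≤ Real.exp s
  hp₂' : (p₂ : ℝ) ≤ Real.exp s
  hq₂' : (q₂ : ℝ) ≤ Real.exp s
  b₁ : ℤ
  b₂ : ℤ
  hb₂ : b₂ ≠ 0
  S : ℕ
  k : ℕ
  hS : 1 ≤ S
  c : ℝ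
  hc : 2000 ≤ c
  hk : 100 * Real.exp c * s ≤ k
  hb : 10 * k * (|(b₁ : ℝ)| + |(b₂ : ℝ)|) ≤ Real.exp S
  ν : ℕ
  hν0 : 0 < ν
  hν : ∀ j, 1 ≤ j → j ≤ S → j ∣ ν
  hν' : (ν : ℝ) ≤ Real.exp (6 * S)

namespace Dat
variable (d : Dat)

noncomputable def l₁ : ℝ := Real.log (d.p₁ / d.q₁)
noncomputable def l₂ : ℝ := Real.log (d.p₂ / d.q₂)
noncomputable def ρ₁ : ℝ := Real.exp (d.l₁ / 5)
noncomputable def ρ₂ : ℝ := Real.exp (d.l₂ / 5)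
noncomputable def Lam : ℝ := d.b₁ * d.l₁ + d.b₂ * d.l₂
noncomputable def θ : ℝ := d.l₁ / d.b₂
noncomputable def η : ℝ := d.Lam / d.b₂
noncomputable def Y : ℝ := 4 * d.S * d.k ^ 2
noncomputable def R : ℝ := Real.exp d.c * d.S

abbrev I : Type := (Fin d.S × Fin (2 * d.k ^ 2)) × (Fin (10 * d.k) × Fin (10 * d.k))

def gam (i : d.I) : ℤ := i.2.1 * d.b₂ - i.2.2 * d.b₁

noncomputable def NN (m X : ℕ) (i : d.I) : ℤ := (Qp_int d.hν X i.1.1 i.1.2 m i.1.1.2.le).choose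

lemma NN_spec (m X : ℕ) (i : d.I) :
    (d.NN m X i : ℚ) = (d.ν : ℚ) ^ m * (hasseDeriv m (Qp d.S i.1.1 i.1.2)).eval (X : ℚ) :=
  (Qp_int d.hν X i.1.1 i.1.2 m i.1.1.2.le).choose_spec

noncomputable def V (v : d.I → ℤ) (m₀ m₁ X : ℕ) : ℝ :=
  ∑ i, ((v i * d.NN m₀ X i * d.gam i ^ m₁ : ℤ) : ℝ) * (d.ρ₁ ^ (i.2.1 * X) * d.ρ₂ ^ (i.2.2 * X))

lemma S1 : (1:ℝ) ≤ d.S := by exact_mod_cast d.hS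

lemma Ec : (1:ℝ) ≤ Real.exp d.c := Real.one_le_exp (by linarith [d.hc])

lemma ks : 100 * d.s ≤ d.k := by
  have := d.hk
  have := d.Ec
  have := d.hs
  nlinarith

lemma k100 : (100:ℝ) ≤ d.k := by linarith [d.ks, d.hs]

lemma Y100 : (100:ℝ) ≤ d.Y := by
  unfold Y
  have h1 := d.k100
  have h2 := d.S1
  nlinarith

lemma kS_le (a : ℝ) (ha : a ≤ 400) : a * d.s * d.k * d.S ≤ d.Y := by
  unfold Y
  have h1 := d.ks
  have h2 := d.S1
  have h3 := d.hs
  have h4 := d.k100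
  have : a * d.s ≤ 4 * d.k := by nlinarith
  have : a * d.s * (d.k * d.S) ≤ 4 * d.k * (d.k * d.S) := by gcongr
  linarith

lemma gam_bound (i : d.I) : |(d.gam i : ℝ)| ≤ Real.exp d.S := by
  refine le_trans ?_ d.hb
  unfold gam
  push_cast
  have h1 : ((i.2.1 : ℕ) : ℝ) ≤ 10 * d.k := by exact_mod_cast i.2.1.2.le
  have h2 : ((i.2.2 : ℕ) : ℝ) ≤ 10 * d.k := by exact_mod_cast i.2.2.2.le
  refine (abs_sub _ _).trans ?_
  rw [abs_mul, abs_mul, Nat.abs_cast, Nat.abs_cast, mul_add, add_comm]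
  gcongr

lemma gam_pow_bound (i : d.I) (m : ℕ) (hm : m ≤ 8 * d.k ^ 2) :
    |(d.gam i : ℝ)| ^ m ≤ Real.exp (2 * d.Y) := by
  calc _ ≤ (Real.exp d.S) ^ m := by gcongr; exact d.gam_bound i
    _ ≤ (Real.exp d.S) ^ (8 * d.k ^ 2) := by
      apply pow_le_pow_right₀ _ hm
      exact Real.one_le_exp (by linarith [d.S1])
    _ = _ := by
      rw [← Real.exp_nat_mul]; congr 1; unfold Y; push_cast; ring

lemma nu_pow_bound (m : ℕ) (hm : m ≤ 8 * d.k ^ 2) :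
    (d.ν : ℝ) ^ m ≤ Real.exp (12 * d.Y) := by
  calc _ ≤ (Real.exp (6 * d.S)) ^ m := by gcongr; exact d.hν'
    _ ≤ (Real.exp (6 * d.S)) ^ (8 * d.k ^ 2) := by
      apply pow_le_pow_right₀ _ hm
      exact Real.one_le_exp (by linarith [d.S1])
    _ = _ := by
      rw [← Real.exp_nat_mul]; congr 1; unfold Y; push_cast; ring

/-- hasse derivative of the polynomial as complex function -/
noncomputable def H (m : ℕ) (i : d.I) (w : ℂ) : ℂ :=
  (hasseDeriv m ((Qp d.S i.1.1 i.1.2).map (algebraMap ℚ ℂ))).eval w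

lemma H_bound (m : ℕ) (i : d.I) (w : ℂ) (e : ℝ) (he : 0 ≤ e) (hw : ‖w‖ ≤ 5 * Real.exp e * d.S) :
    ‖d.H m i w‖ ≤ Real.exp ((3 + e) / 2 * d.Y) := by
  have hS := d.S1
  have he1 : 1 ≤ Real.exp e := Real.one_le_exp he
  have h := Qp_hasse_bound d.S i.1.1 i.1.2 m d.hS i.1.1.2.le (5 * Real.exp e * d.S) (by positivity) w hw
  refine h.trans ?_
  have h7 : (5 * Real.exp e * d.S + 1 + d.S) / d.S ≤ 7 * Real.exp e := by
    rw [div_le_iff₀ (by linarith)]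
    nlinarith
  have h7' : (7:ℝ) ≤ Real.exp 2 := by
    have : Real.exp 2 = Real.exp 1 ^ 2 := by rw [← Real.exp_nat_mul]; norm_num
    rw [this]; nlinarith [Real.exp_one_gt_d9]
  have hb : (i.1.2 : ℕ) + 1 ≤ 2 * d.k ^ 2 := i.1.2.2
  calc _ ≤ (Real.exp 1 * (Real.exp 2 * Real.exp e)) ^ (d.S * (i.1.2 + 1)) := by
        gcongr
        exact h7.trans (by gcongr)
    _ ≤ (Real.exp 1 * (Real.exp 2 * Real.exp e)) ^ (d.S * (2 * d.k ^ 2)) := by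
        apply pow_le_pow_right₀
        · rw [← Real.exp_add, ← Real.exp_add]; exact Real.one_le_exp (by linarith)
        · gcongr
    _ = _ := by
        rw [← Real.exp_add, ← Real.exp_add, ← Real.exp_nat_mul]; congr 1; unfold Y; push_cast; ring

lemma NN_eq (m X : ℕ) (i : d.I) : (d.NN m X i : ℂ) = (d.ν : ℂ) ^ m * d.H m i X := by
  have h := congrArg (fun x : ℚ => (x : ℂ)) (d.NN_spec m X i)
  push_cast at h
  rw [h]
  congr 1
  unfold H
  rw [hasse_map_aux]
  have : (X : ℂ) = algebraMap ℚ ℂ (X : ℚ) := by simp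
  rw [this, eval_map_algebraMap, Polynomial.aeval_algebraMap_apply]
  simp

lemma NN_bound (m X : ℕ) (i : d.I) (hm : m ≤ 8 * d.k ^ 2) (hX : X ≤ 5 * d.S) :
    |(d.NN m X i : ℝ)| ≤ Real.exp (14 * d.Y) := by
  have h1 : |(d.NN m X i : ℝ)| = ‖(d.NN m X i : ℂ)‖ := by rw [Complex.norm_intCast]
  rw [h1, NN_eq, norm_mul, norm_pow, Complex.norm_natCast]
  have h2 := d.H_bound m i X 0 le_rfl (by
    rw [Complex.norm_natCast, Real.exp_zero, mul_one]; exact_mod_cast hX)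
  have h3 := d.nu_pow_bound m hm
  calc _ ≤ Real.exp (12 * d.Y) * Real.exp ((3 + 0) / 2 * d.Y) := by gcongr
    _ ≤ _ := by
      rw [← Real.exp_add]
      apply Real.exp_le_exp.2
      linarith [d.Y100]

lemma card_I : Fintype.card d.I = 200 * d.S * d.k ^ 4 := by
  simp only [Fintype.card_prod, Fintype.card_fin]; ring

lemma card_I_bound : (Fintype.card d.I : ℝ) ≤ Real.exp (2 * d.Y) := by
  rw [card_I]
  push_cast
  have hY := d.Y100
  have h1 : 1 + d.Y + d.Y ^ 2 / 2 ≤ Real.exp d.Y := Real.quadratic_le_exp_of_nonneg (by linarith)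
  have h2 : (200 * d.S * d.k ^ 4 : ℝ) ≤ 12.5 * d.Y ^ 2 := by
    have hS := d.S1
    unfold Y
    have : (d.S : ℝ) * d.k ^ 4 ≤ d.S * d.S * d.k ^ 4 := by
      have : (0:ℝ) ≤ (d.S : ℝ) * d.k ^ 4 := by positivity
      nlinarith
    nlinarith
  have h3 : Real.exp (2 * d.Y) = Real.exp d.Y * Real.exp d.Y := by rw [← Real.exp_add]; congr 1; ring
  rw [h3]
  have h4 : 100 ≤ Real.exp d.Y := by nlinarith
  have : 100 * Real.exp d.Y ≤ Real.exp d.Y * Real.exp d.Y := by gcongr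
  nlinarith

lemma ρ₁_pos : 0 < d.ρ₁ := Real.exp_pos _
lemma ρ₂_pos : 0 < d.ρ₂ := Real.exp_pos _

lemma ρ₁_5 : d.ρ₁ ^ 5 = d.p₁ / d.q₁ := by
  have h1 : (0:ℝ) < d.p₁ := by exact_mod_cast d.hp₁
  have h2 : (0:ℝ) < d.q₁ := by exact_mod_cast d.hq₁
  unfold ρ₁ l₁
  rw [← Real.exp_nat_mul]
  push_cast
  rw [mul_div_cancel₀ _ (by norm_num), Real.exp_log (by positivity)]

lemma ρ₂_5 : d.ρ₂ ^ 5 = d.p₂ / d.q₂ := by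
  have h1 : (0:ℝ) < d.p₂ := by exact_mod_cast d.hp₂
  have h2 : (0:ℝ) < d.q₂ := by exact_mod_cast d.hq₂
  unfold ρ₂ l₂
  rw [← Real.exp_nat_mul]
  push_cast
  rw [mul_div_cancel₀ _ (by norm_num), Real.exp_log (by positivity)]

/-- Siegel step. -/
lemma stepA : ∃ v : d.I → ℤ, v ≠ 0 ∧ (∀ i, |(v i : ℝ)| ≤ Real.exp (19 * d.Y)) ∧
    ∀ m₀ < 8 * d.k ^ 2, ∀ m₁ < 8 * d.k ^ 2, ∀ x < d.S, d.V v m₀ m₁ (5 * x) = 0 := by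
  have hq₁ : (0:ℝ) < d.q₁ := by exact_mod_cast d.hq₁
  have hq₂ : (0:ℝ) < d.q₂ := by exact_mod_cast d.hq₂
  let A : (Fin (8 * d.k^2) × Fin (8 * d.k^2) × Fin d.S) → d.I → ℤ := fun r i =>
    (d.NN r.1 (5 * r.2.2) i * d.gam i ^ (r.2.1 : ℕ)) *
      (((d.p₁ : ℤ) ^ ((i.2.1 : ℕ) * r.2.2) * (d.q₁ : ℤ) ^ ((10 * d.k - i.2.1 : ℕ) * r.2.2)) *
       ((d.p₂ : ℤ) ^ ((i.2.2 : ℕ) * r.2.2) * (d.q₂ : ℤ) ^ ((10 * d.k - i.2.2 : ℕ) * r.2.2)))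
  have hk0 : 0 < d.k := by
    have := d.k100
    have h : (0:ℝ) < d.k := by linarith
    exact_mod_cast h
  have hY := d.Y100
  have hE1 : 1 ≤ Real.exp d.s := Real.one_le_exp (by linarith [d.hs])
  obtain ⟨v, hv0, hv, hvb⟩ := siegel_wrap A (Real.exp (17 * d.Y)) (Real.one_le_exp (by linarith)) (by
      rintro ⟨m₀, m₁, x⟩ i
      simp only [A]
      push_cast
      rw [abs_mul, abs_mul, abs_pow]
      have h1 := d.NN_bound m₀ (5 * x) i m₀.2.le (by have := x.2; omega)
      have h2 := d.gam_pow_bound i m₁ m₁.2.le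
      have hpart : ∀ (p q : ℕ) (j : Fin (10 * d.k)), (p : ℝ) ≤ Real.exp d.s → (q : ℝ) ≤ Real.exp d.s →
          (p:ℝ) ^ ((j : ℕ) * x) * (q:ℝ) ^ ((10 * d.k - j : ℕ) * x) ≤ Real.exp (d.Y / 2) := by
        intro p q j hp hq
        calc _ ≤ (Real.exp d.s) ^ ((j : ℕ) * x) * (Real.exp d.s) ^ ((10 * d.k - j : ℕ) * x) := by gcongr
          _ = (Real.exp d.s) ^ (10 * d.k * x) := by
            rw [← pow_add, ← add_mul]; congr 2; have := j.2; omega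
          _ ≤ (Real.exp d.s) ^ (10 * d.k * d.S) := by
            apply pow_le_pow_right₀ hE1
            have := x.2.le
            gcongr
          _ ≤ _ := by
            rw [← Real.exp_nat_mul]; apply Real.exp_le_exp.2
            push_cast
            have := d.kS_le 20 (by norm_num)
            linarith
      have h3 := hpart _ _ i.2.1 d.hp₁' d.hq₁'
      have h4 := hpart _ _ i.2.2 d.hp₂' d.hq₂'
      rw [abs_of_nonneg (a := _ * _ * (_ * _)) (by positivity)]
      calc _ ≤ Real.exp (14 * d.Y) * Real.exp (2 * d.Y) * (Real.exp (d.Y / 2) * Real.exp (d.Y / 2)) := by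
            gcongr
        _ = _ := by
            rw [← Real.exp_add, ← Real.exp_add, ← Real.exp_add]; congr 1; ring)
    (by
      rw [card_I]
      simp only [Fintype.card_prod, Fintype.card_fin]
      have : 0 ≤ d.S * d.k ^ 4 := Nat.zero_le _
      nlinarith)
    (by
      simp only [Fintype.card_prod, Fintype.card_fin]
      have := d.hS
      positivity)
  refine ⟨v, hv0, ?_, ?_⟩
  · intro i
    refine (hvb i).trans ?_
    calc _ ≤ Real.exp (2 * d.Y) * Real.exp (17 * d.Y) := by gcongr; exact d.card_I_bound
      _ = _ := by rw [← Real.exp_add]; congr 1; ring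
  · intro m₀ hm₀ m₁ hm₁ x hx
    have h := hv (⟨m₀, hm₀⟩, ⟨m₁, hm₁⟩, ⟨x, hx⟩)
    have h' : ((d.q₁ : ℝ) ^ (10 * d.k * x) * (d.q₂ : ℝ) ^ (10 * d.k * x)) * d.V v m₀ m₁ (5 * x) = 0 := by
      have h2 := congrArg (fun z : ℤ => (z : ℝ)) h
      simp only [A] at h2
      push_cast at h2
      rw [← h2]
      unfold V
      rw [Finset.mul_sum]
      apply Finset.sum_congr rfl
      intro i _
      have e1 : (d.q₁ : ℝ) ^ (10 * d.k * x) = (d.q₁ : ℝ) ^ ((i.2.1 : ℕ) * x) * (d.q₁ : ℝ) ^ ((10 * d.k - i.2.1 : ℕ) * x) := by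
        rw [← pow_add, ← add_mul]; congr 2; have := i.2.1.2; omega
      have e2 : (d.q₂ : ℝ) ^ (10 * d.k * x) = (d.q₂ : ℝ) ^ ((i.2.2 : ℕ) * x) * (d.q₂ : ℝ) ^ ((10 * d.k - i.2.2 : ℕ) * x) := by
        rw [← pow_add, ← add_mul]; congr 2; have := i.2.2.2; omega
      have e3 : d.ρ₁ ^ ((i.2.1 : ℕ) * (5 * x)) = (d.p₁ : ℝ) ^ ((i.2.1 : ℕ) * x) / (d.q₁ : ℝ) ^ ((i.2.1 : ℕ) * x) := by
        rw [← div_pow, ← d.ρ₁_5, ← pow_mul]; congr 1; ring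
      have e4 : d.ρ₂ ^ ((i.2.2 : ℕ) * (5 * x)) = (d.p₂ : ℝ) ^ ((i.2.2 : ℕ) * x) / (d.q₂ : ℝ) ^ ((i.2.2 : ℕ) * x) := by
        rw [← div_pow, ← d.ρ₂_5, ← pow_mul]; congr 1; ring
      rw [e1, e2, e3, e4]
      push_cast
      field_simp
    rcases mul_eq_zero.1 h' with h | h
    · exfalso
      have : 0 < (d.q₁ : ℝ) ^ (10 * d.k * x) * (d.q₂ : ℝ) ^ (10 * d.k * x) := by positivity
      exact this.ne' h
    · exact h
end Dat

open Polynomial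

namespace Dat
variable (d : Dat)

lemma log_bd (p q : ℕ) (s : ℝ) (hp : 0 < p) (hq : 0 < q) (hp' : (p:ℝ) ≤ Real.exp s) (hq' : (q:ℝ) ≤ Real.exp s) :
    |Real.log ((p:ℝ) / q)| ≤ s := by
  have h1 : (1:ℝ) ≤ p := by exact_mod_cast hp
  have h2 : (1:ℝ) ≤ q := by exact_mod_cast hq
  rw [Real.log_div (by positivity) (by positivity)]
  have a1 := Real.log_nonneg h1
  have a2 := Real.log_nonneg h2
  have a3 := (Real.log_le_iff_le_exp (by linarith)).2 hp'
  have a4 := (Real.log_le_iff_le_exp (by linarith)).2 hq'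
  rw [abs_le]; constructor <;> linarith

lemma l₁_bd : |d.l₁| ≤ d.s := log_bd _ _ _ d.hp₁ d.hq₁ d.hp₁' d.hq₁'
lemma l₂_bd : |d.l₂| ≤ d.s := log_bd _ _ _ d.hp₂ d.hq₂ d.hp₂' d.hq₂'

lemma gam_theta (i : d.I) : (d.gam i : ℝ) * d.θ + (i.2.2 : ℕ) * d.η = (i.2.1 : ℕ) * d.l₁ + (i.2.2 : ℕ) * d.l₂ := by
  have hb : (d.b₂ : ℝ) ≠ 0 := by exact_mod_cast d.hb₂
  unfold gam θ η Lam
  push_cast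
  field_simp
  ring

lemma V_eq (v : d.I → ℤ) (m₀ m₁ X : ℕ) : (d.V v m₀ m₁ X : ℂ) = (d.ν : ℂ) ^ m₀ *
    ∑ i, (v i : ℂ) * d.H m₀ i X * (d.gam i : ℂ) ^ m₁ *
      Complex.exp ((d.gam i : ℂ) * d.θ * (X / 5) + (i.2.2 : ℕ) * d.η * (X / 5)) := by
  unfold V
  rw [Finset.mul_sum]
  push_cast
  apply Finset.sum_congr rfl
  intro i _
  have h1 : (d.ρ₁ : ℂ) ^ ((i.2.1 : ℕ) * X) * (d.ρ₂ : ℂ) ^ ((i.2.2 : ℕ) * X) =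
      Complex.exp ((d.gam i : ℂ) * d.θ * (X / 5) + (i.2.2 : ℕ) * d.η * (X / 5)) := by
    unfold ρ₁ ρ₂
    push_cast
    rw [← Complex.exp_nat_mul, ← Complex.exp_nat_mul, ← Complex.exp_add]
    congr 1
    have h := congrArg (fun x : ℝ => (x : ℂ)) (d.gam_theta i)
    push_cast at h
    rw [← add_mul, h]
    push_cast
    ring
  rw [h1, NN_eq]
  ring

/-- the family of auxiliary functions -/
noncomputable def Fam (v : d.I → ℤ) (m₀ m₁ : ℕ) (z : ℂ) : ℂ :=
  ∑ i, (v i : ℂ) * d.H m₀ i (5 * z) * (d.gam i : ℂ) ^ m₁ *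
      Complex.exp ((d.gam i : ℂ) * d.θ * z + (i.2.2 : ℕ) * d.η * uu (4 * d.k ^ 2) z)

noncomputable def Gam (v : d.I → ℤ) (m₀ m₁ : ℕ) (z : ℂ) : ℂ :=
  ∑ i, (v i : ℂ) * d.H m₀ i (5 * z) * (d.gam i : ℂ) ^ m₁ * ((i.2.2 : ℕ) * d.η) *
      Complex.exp ((d.gam i : ℂ) * d.θ * z + (i.2.2 : ℕ) * d.η * uu (4 * d.k ^ 2) z)

lemma H_deriv (m : ℕ) (i : d.I) (z : ℂ) :
    HasDerivAt (fun z => d.H m i (5 * z)) (5 * (m + 1) * d.H (m + 1) i (5 * z)) z := by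
  unfold H
  set P := (Qp d.S i.1.1 i.1.2).map (algebraMap ℚ ℂ)
  have h1 : derivative (hasseDeriv m P) = ((m + 1 : ℕ) : ℂ[X]) * hasseDeriv (m+1) P := by
    have := hasseDeriv_comp (R := ℂ) 1 m
    have h2 := congrArg (fun φ => φ P) this
    simp only [LinearMap.comp_apply, hasseDeriv_one, LinearMap.smul_apply] at h2
    rw [h2, Nat.choose_one_right, nsmul_eq_mul, add_comm 1 m]
  have h3 := (hasseDeriv m P).hasDerivAt (5 * z)
  have h4 : HasDerivAt (fun z : ℂ => 5 * z) 5 z := by simpa using (hasDerivAt_id z).const_mul (5:ℂ)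
  refine (h3.comp z h4).congr_deriv ?_
  rw [h1, eval_mul, eval_natCast]
  push_cast; ring

lemma Fam_deriv (v : d.I → ℤ) (m₀ m₁ : ℕ) (z : ℂ) :
    HasDerivAt (d.Fam v m₀ m₁) ((5 * (m₀ + 1)) * d.Fam v (m₀ + 1) m₁ z + d.θ * d.Fam v m₀ (m₁ + 1) z
      + (1 - Complex.exp (2 * Real.pi * Complex.I * z)) ^ (4 * d.k ^ 2) * d.Gam v m₀ m₁ z) z := by
  have h1 : ∀ i : d.I, HasDerivAt (fun z => (v i : ℂ) * d.H m₀ i (5 * z) * (d.gam i : ℂ) ^ m₁ *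
      Complex.exp ((d.gam i : ℂ) * d.θ * z + (i.2.2 : ℕ) * d.η * uu (4 * d.k ^ 2) z))
      ((5 * (m₀ + 1)) * ((v i : ℂ) * d.H (m₀+1) i (5 * z) * (d.gam i : ℂ) ^ m₁ *
      Complex.exp ((d.gam i : ℂ) * d.θ * z + (i.2.2 : ℕ) * d.η * uu (4 * d.k ^ 2) z))
      + d.θ * ((v i : ℂ) * d.H m₀ i (5 * z) * (d.gam i : ℂ) ^ (m₁+1) *
      Complex.exp ((d.gam i : ℂ) * d.θ * z + (i.2.2 : ℕ) * d.η * uu (4 * d.k ^ 2) z))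
      + (1 - Complex.exp (2 * Real.pi * Complex.I * z)) ^ (4 * d.k ^ 2) *
      ((v i : ℂ) * d.H m₀ i (5 * z) * (d.gam i : ℂ) ^ m₁ * ((i.2.2 : ℕ) * d.η) *
      Complex.exp ((d.gam i : ℂ) * d.θ * z + (i.2.2 : ℕ) * d.η * uu (4 * d.k ^ 2) z))) z := by
    intro i
    have a1 : HasDerivAt (fun z : ℂ => (d.gam i : ℂ) * d.θ * z) ((d.gam i : ℂ) * d.θ) z := by
      simpa using (hasDerivAt_id z).const_mul ((d.gam i : ℂ) * d.θ)
    have a2 := (uu_deriv (4 * d.k ^ 2) z).const_mul (((i.2.2 : ℕ) : ℂ) * d.η)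
    have a3 := (a1.add a2).cexp
    have a4 := (((d.H_deriv m₀ i z).const_mul (v i : ℂ)).mul_const ((d.gam i : ℂ) ^ m₁)).mul a3
    refine a4.congr_deriv ?_
    simp only [Pi.add_apply]
    ring
  have h2 := HasDerivAt.fun_sum (u := Finset.univ) fun i _ => h1 i
  refine h2.congr_deriv ?_
  unfold Fam Gam
  rw [Finset.sum_add_distrib, Finset.sum_add_distrib, Finset.mul_sum, Finset.mul_sum, Finset.mul_sum]

lemma Gam_diff (v : d.I → ℤ) (m₀ m₁ : ℕ) : Differentiable ℂ (d.Gam v m₀ m₁) := by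
  have h1 : Differentiable ℂ (uu (4 * d.k ^ 2)) := fun z => (uu_deriv _ z).differentiableAt
  have h2 : ∀ i, Differentiable ℂ (fun z => d.H m₀ i (5 * z)) := fun i z => (d.H_deriv m₀ i z).differentiableAt
  unfold Gam
  fun_prop

lemma Fam_VO (v : d.I → ℤ)
    (hv : ∀ m₀ < 8 * d.k ^ 2, ∀ m₁ < 8 * d.k ^ 2, ∀ x < d.S, d.V v m₀ m₁ (5 * x) = 0)
    (m₀ m₁ : ℕ) (hm₀ : m₀ < 4 * d.k ^ 2) (hm₁ : m₁ < 4 * d.k ^ 2) (x : ℕ) (hx : x < d.S) :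
    VO (4 * d.k ^ 2) (x : ℂ) (d.Fam v m₀ m₁) := by
  refine VO_family (d.Fam v) (d.Gam v) _ (fun i => 5 * ((i:ℂ) + 1)) d.θ x ?_ (d.Gam_diff v) ?_ (8 * d.k ^ 2)
    (4 * d.k ^ 2) (uu_VO _ x) ?_ _ le_rfl _ _ (by omega) (by omega)
  · intro i j z; exact (d.Fam_deriv v i j z).differentiableAt
  · intro i j z; exact (d.Fam_deriv v i j z).deriv
  · intro i j hi hj
    have h := d.V_eq v i j (5 * x)
    rw [hv i hi j hj x hx] at h
    have hν : (d.ν : ℂ) ^ i ≠ 0 := pow_ne_zero _ (by exact_mod_cast d.hν0.ne')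
    have h2 := (mul_eq_zero.1 h.symm |>.resolve_left hν)
    unfold Fam
    rw [← h2]
    apply Finset.sum_congr rfl
    intro l _
    rw [uu_nat]
    have : (((5 * x : ℕ) : ℂ) / 5) = x := by push_cast; field_simp
    rw [this]
    push_cast
    rfl

/-- smallness hypothesis -/
def Small : Prop :=
  10 * d.k * |d.Lam| * (d.R + 2 ^ (4 * d.k ^ 2) * Real.exp (7 * d.R * (4 * d.k ^ 2 : ℕ))) ≤ Real.exp (-d.c * d.Y)

lemma R1 : 1 ≤ d.R := by
  unfold R; nlinarith [d.Ec, d.S1]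

lemma delta_le_one : Real.exp (-d.c * d.Y) ≤ 1 := by
  rw [Real.exp_le_one_iff]; nlinarith [d.hc, d.Y100]

lemma eta_le : |d.η| ≤ |d.Lam| := by
  unfold η
  rw [abs_div]
  apply div_le_self (abs_nonneg _)
  exact_mod_cast Int.one_le_abs d.hb₂

lemma small_mul (h : d.Small) (i : d.I) (w : ℂ)
    (hw : ‖w‖ ≤ d.R + 2 ^ (4 * d.k ^ 2) * Real.exp (7 * d.R * (4 * d.k ^ 2 : ℕ))) :
    ‖((i.2.2 : ℕ) : ℂ) * d.η * w‖ ≤ Real.exp (-d.c * d.Y) := by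
  refine le_trans ?_ h
  rw [norm_mul, norm_mul, Complex.norm_natCast, Complex.norm_real, Real.norm_eq_abs]
  have h2 : ((i.2.2 : ℕ) : ℝ) ≤ 10 * d.k := by exact_mod_cast i.2.2.2.le
  have := d.eta_le
  gcongr

lemma small_lam (h : d.Small) : |d.Lam| ≤ 1 := by
  have h1 := h.trans d.delta_le_one
  have h2 := d.R1
  have h3 := d.k100
  have h4 : 1 ≤ 10 * (d.k:ℝ) * (d.R + 2 ^ (4 * d.k ^ 2) * Real.exp (7 * d.R * (4 * d.k ^ 2 : ℕ))) := by
    have : 0 ≤ (2:ℝ) ^ (4 * d.k ^ 2) * Real.exp (7 * d.R * (4 * d.k ^ 2 : ℕ)) := by positivity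
    nlinarith
  have h5 := abs_nonneg d.Lam
  nlinarith

lemma gt_bound (h : d.Small) (i : d.I) : |(d.gam i : ℝ) * d.θ| ≤ 30 * d.k * d.s := by
  have h1 := d.gam_theta i
  have e : (d.gam i : ℝ) * d.θ = (i.2.1 : ℕ) * d.l₁ + (i.2.2 : ℕ) * d.l₂ - (i.2.2 : ℕ) * d.η := by linarith
  have h2 : ((i.2.1 : ℕ) : ℝ) ≤ 10 * d.k := by exact_mod_cast i.2.1.2.le
  have h3 : ((i.2.2 : ℕ) : ℝ) ≤ 10 * d.k := by exact_mod_cast i.2.2.2.le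
  have h4 : |d.η| ≤ d.s := d.eta_le.trans ((d.small_lam h).trans d.hs)
  have h5 := d.l₁_bd
  have h6 := d.l₂_bd
  rw [e]
  refine (abs_sub _ _).trans ?_
  have a1 : |((i.2.1 : ℕ):ℝ) * d.l₁| ≤ 10 * d.k * d.s := by
    rw [abs_mul, Nat.abs_cast]; gcongr
  have a2 : |((i.2.2 : ℕ):ℝ) * d.l₂| ≤ 10 * d.k * d.s := by
    rw [abs_mul, Nat.abs_cast]; gcongr
  have a3 : |((i.2.2 : ℕ):ℝ) * d.η| ≤ 10 * d.k * d.s := by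
    rw [abs_mul, Nat.abs_cast]; gcongr
  have := abs_add_le (((i.2.1 : ℕ):ℝ) * d.l₁) (((i.2.2 : ℕ):ℝ) * d.l₂)
  linarith

lemma gtz_bound (h : d.Small) (i : d.I) (z : ℂ) (hz : ‖z‖ ≤ d.R) : ‖(d.gam i : ℂ) * d.θ * z‖ ≤ d.Y := by
  rw [norm_mul]
  have : ‖(d.gam i : ℂ) * d.θ‖ = |(d.gam i : ℝ) * d.θ| := by
    rw [← Real.norm_eq_abs, ← Complex.norm_real]; push_cast; rfl
  rw [this]
  have hs := d.hs
  calc _ ≤ 30 * d.k * d.s * d.R := by gcongr; exact d.gt_bound h i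
    _ ≤ _ := by
      unfold R Y
      have h1 := d.hk
      have h2 := d.S1
      have : 30 * Real.exp d.c * d.s ≤ 4 * d.k := by
        have : 0 ≤ Real.exp d.c * d.s := by positivity
        linarith
      calc 30 * d.k * d.s * (Real.exp d.c * d.S) = 30 * Real.exp d.c * d.s * (d.k * d.S) := by ring
        _ ≤ 4 * d.k * (d.k * d.S) := by gcongr
        _ = _ := by ring

lemma norm_cexp_le (z : ℂ) (r : ℝ) (h : ‖z‖ ≤ r) : ‖Complex.exp z‖ ≤ Real.exp r := by
  rw [Complex.norm_exp]
  exact Real.exp_le_exp.2 ((Complex.re_le_norm z).trans h)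

lemma uu_bd (z : ℂ) (hz : ‖z‖ ≤ d.R) : ‖uu (4 * d.k ^ 2) z‖ ≤ d.R + 2 ^ (4 * d.k ^ 2) * Real.exp (7 * d.R * (4 * d.k ^ 2 : ℕ)) :=
  uu_bound _ _ (by linarith [d.R1]) z hz

/-- sum over the index set, termwise bounded -/
lemma sum_bd (f : d.I → ℂ) (B : ℝ) (hB : ∀ i, ‖f i‖ ≤ Real.exp B) : ‖∑ i, f i‖ ≤ Real.exp (2 * d.Y + B) := by
  calc ‖∑ i, f i‖ ≤ ∑ i : d.I, Real.exp B := norm_sum_le_of_le _ fun i _ => hB i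
    _ = Fintype.card d.I * Real.exp B := by rw [Finset.sum_const, Finset.card_univ, nsmul_eq_mul]
    _ ≤ Real.exp (2 * d.Y) * Real.exp B := by gcongr; exact d.card_I_bound
    _ = _ := by rw [← Real.exp_add]

lemma Fam_bound (v : d.I → ℤ) (hvb : ∀ i, |(v i : ℝ)| ≤ Real.exp (19 * d.Y)) (h : d.Small)
    (m₀ m₁ : ℕ) (hm₁ : m₁ < 4 * d.k ^ 2) (z : ℂ) (hz : ‖z‖ ≤ d.R) :
    ‖d.Fam v m₀ m₁ z‖ ≤ Real.exp ((27 + d.c / 2) * d.Y) := by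
  have hY := d.Y100
  refine (d.sum_bd _ ((25 + d.c / 2) * d.Y) ?_).trans (by apply Real.exp_le_exp.2; linarith)
  intro i
  have h1 : ‖(v i : ℂ)‖ ≤ Real.exp (19 * d.Y) := by rw [Complex.norm_intCast]; exact hvb i
  have h2 : ‖d.H m₀ i (5 * z)‖ ≤ _ := d.H_bound m₀ i (5 * z) d.c (by linarith [d.hc]) (by
    rw [norm_mul]; unfold R at hz; simp only [Complex.norm_ofNat]; linarith)
  have h3 : ‖(d.gam i : ℂ) ^ m₁‖ ≤ Real.exp (2 * d.Y) := by
    rw [norm_pow, Complex.norm_intCast]; exact d.gam_pow_bound i m₁ (by omega)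
  have h4 := norm_cexp_le ((d.gam i : ℂ) * d.θ * z + (i.2.2 : ℕ) * d.η * uu (4 * d.k ^ 2) z) (d.Y + 1) (by
    refine (norm_add_le _ _).trans (add_le_add (d.gtz_bound h i z hz) ?_)
    exact (d.small_mul h i _ (d.uu_bd z hz)).trans d.delta_le_one)
  rw [norm_mul, norm_mul, norm_mul]
  calc _ ≤ Real.exp (19 * d.Y) * Real.exp ((3 + d.c) / 2 * d.Y) * Real.exp (2 * d.Y) * Real.exp (d.Y + 1) := by gcongr
    _ ≤ _ := by
      rw [← Real.exp_add, ← Real.exp_add, ← Real.exp_add]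
      apply Real.exp_le_exp.2
      linarith

lemma exp_sub_small (a b : ℂ) (δ : ℝ) (hδ : δ ≤ 1) (ha : ‖a‖ ≤ δ) (hb : ‖b‖ ≤ δ) :
    ‖Complex.exp a - Complex.exp b‖ ≤ 4 * δ := by
  have h1 := Complex.norm_exp_sub_one_le (ha.trans hδ)
  have h2 := Complex.norm_exp_sub_one_le (hb.trans hδ)
  have : Complex.exp a - Complex.exp b = (Complex.exp a - 1) - (Complex.exp b - 1) := by ring
  rw [this]
  refine (norm_sub_le _ _).trans ?_
  linarith

lemma stepB (v : d.I → ℤ) (hvb : ∀ i, |(v i : ℝ)| ≤ Real.exp (19 * d.Y)) (h : d.Small)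
    (hv : ∀ m₀ < 8 * d.k ^ 2, ∀ m₁ < 8 * d.k ^ 2, ∀ x < d.S, d.V v m₀ m₁ (5 * x) = 0)
    (m₀ m₁ : ℕ) (hm₀ : m₀ < 4 * d.k ^ 2) (hm₁ : m₁ < 4 * d.k ^ 2) (X : ℕ) (hX : X < 5 * d.S) :
    |d.V v m₀ m₁ X| ≤ Real.exp ((41 - d.c / 2) * d.Y) := by
  have hY := d.Y100
  have hc := d.hc
  have hS := d.S1
  have hXS : (X:ℝ) / 5 ≤ d.S := by
    rw [div_le_iff₀ (by norm_num)]
    have : (X:ℝ) ≤ 5 * d.S := by exact_mod_cast hX.le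
    linarith
  have hE3 : 3 ≤ Real.exp d.c := by
    have := Real.add_one_le_exp d.c; linarith
  have hRS : (d.S:ℝ) < d.R := by unfold R; nlinarith
  have hzR : ‖((X:ℂ) / 5)‖ ≤ d.R := by
    rw [norm_div, Complex.norm_natCast]; simp only [Complex.norm_ofNat]; linarith
  -- the value of the auxiliary function
  have h1 := schwarz (f := d.Fam v m₀ m₁) (fun z => (d.Fam_deriv v m₀ m₁ z).differentiableAt) (4 * d.k ^ 2) d.S
    (fun x hx => d.Fam_VO v hv m₀ m₁ hm₀ hm₁ x hx) d.R _ hRS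
    (fun z hz => d.Fam_bound v hvb h m₀ m₁ hm₁ z hz) ((X:ℝ) / 5) (by positivity) hXS
  have h2 : ((d.S:ℝ) / (d.R - d.S)) ^ (4 * d.k ^ 2 * d.S) ≤ Real.exp ((1 - d.c) * d.Y) := by
    have : (d.S:ℝ) / (d.R - d.S) ≤ Real.exp (1 - d.c) := by
      rw [div_le_iff₀ (by linarith)]
      unfold R
      rw [Real.exp_sub, div_mul_eq_mul_div, le_div_iff₀ (Real.exp_pos _)]
      have he := Real.exp_one_gt_d9
      have : Real.exp d.c * d.S ≤ 2 * (Real.exp d.c * d.S - d.S) := by nlinarith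
      have h0 : 0 ≤ Real.exp d.c * d.S - d.S := by nlinarith
      nlinarith
    calc _ ≤ (Real.exp (1 - d.c)) ^ (4 * d.k ^ 2 * d.S) := by
          gcongr
      _ = _ := by rw [← Real.exp_nat_mul]; congr 1; unfold Y; push_cast; ring
  have h3 : ‖d.Fam v m₀ m₁ ((X:ℂ) / 5)‖ ≤ Real.exp ((28 - d.c / 2) * d.Y) := by
    have e : (((X:ℝ) / 5 : ℝ) : ℂ) = (X:ℂ) / 5 := by push_cast; rfl
    rw [e] at h1
    refine h1.trans ?_
    calc _ ≤ Real.exp ((27 + d.c / 2) * d.Y) * Real.exp ((1 - d.c) * d.Y) := by gcongr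
      _ = _ := by rw [← Real.exp_add]; congr 1; ring
  -- the difference
  set D : ℂ := ∑ i, (v i : ℂ) * d.H m₀ i X * (d.gam i : ℂ) ^ m₁ *
      (Complex.exp ((d.gam i : ℂ) * d.θ * (X / 5)) * (Complex.exp ((i.2.2 : ℕ) * d.η * (X / 5)) -
        Complex.exp ((i.2.2 : ℕ) * d.η * uu (4 * d.k ^ 2) (X / 5)))) with hD
  have h4 : ‖D‖ ≤ Real.exp ((27 - d.c) * d.Y) := by
    refine (d.sum_bd _ ((25 - d.c) * d.Y) ?_).trans (by apply Real.exp_le_exp.2; linarith)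
    intro i
    have a1 : ‖(v i : ℂ)‖ ≤ Real.exp (19 * d.Y) := by rw [Complex.norm_intCast]; exact hvb i
    have a2 : ‖d.H m₀ i X‖ ≤ _ := d.H_bound m₀ i X 0 le_rfl (by
      rw [Complex.norm_natCast, Real.exp_zero, mul_one]; exact_mod_cast hX.le)
    have a3 : ‖(d.gam i : ℂ) ^ m₁‖ ≤ Real.exp (2 * d.Y) := by
      rw [norm_pow, Complex.norm_intCast]; exact d.gam_pow_bound i m₁ (by omega)
    have a4 := norm_cexp_le _ _ (d.gtz_bound h i (X / 5) hzR)
    have a5 := exp_sub_small _ _ _ d.delta_le_one (d.small_mul h i (X / 5) (hzR.trans (by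
      have : 0 ≤ (2:ℝ) ^ (4 * d.k ^ 2) * Real.exp (7 * d.R * (4 * d.k ^ 2 : ℕ)) := by positivity
      linarith))) (d.small_mul h i _ (d.uu_bd (X / 5) hzR))
    rw [norm_mul, norm_mul, norm_mul, norm_mul]
    have h4e : (4:ℝ) ≤ Real.exp d.Y := by have := Real.add_one_le_exp d.Y; linarith
    calc _ ≤ Real.exp (19 * d.Y) * Real.exp ((3 + 0) / 2 * d.Y) * Real.exp (2 * d.Y) *
          (Real.exp d.Y * (Real.exp d.Y * Real.exp (-d.c * d.Y))) := by
            gcongr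
            refine a5.trans ?_
            gcongr
      _ ≤ _ := by
        rw [← Real.exp_add, ← Real.exp_add, ← Real.exp_add, ← Real.exp_add, ← Real.exp_add]
        apply Real.exp_le_exp.2
        linarith
  have h5 : (d.V v m₀ m₁ X : ℂ) = (d.ν : ℂ) ^ m₀ * (d.Fam v m₀ m₁ ((X:ℂ) / 5) + D) := by
    rw [V_eq, hD]
    unfold Fam
    rw [← Finset.sum_add_distrib]
    congr 1
    apply Finset.sum_congr rfl
    intro i _
    have : (5:ℂ) * (X / 5) = X := by field_simp
    rw [this, Complex.exp_add, Complex.exp_add]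
    ring
  have h6 : |d.V v m₀ m₁ X| = ‖(d.V v m₀ m₁ X : ℂ)‖ := by rw [Complex.norm_real, Real.norm_eq_abs]
  rw [h6, h5, norm_mul, norm_pow, Complex.norm_natCast]
  have h7 := d.nu_pow_bound m₀ (by omega)
  have h8 : ‖d.Fam v m₀ m₁ ((X:ℂ) / 5) + D‖ ≤ Real.exp ((29 - d.c / 2) * d.Y) := by
    refine (norm_add_le _ _).trans ?_
    have : Real.exp ((27 - d.c) * d.Y) ≤ Real.exp ((28 - d.c / 2) * d.Y) := by
      apply Real.exp_le_exp.2; nlinarith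
    have h2e : (2:ℝ) ≤ Real.exp d.Y := by have := Real.add_one_le_exp d.Y; linarith
    have e : Real.exp ((29 - d.c / 2) * d.Y) = Real.exp d.Y * Real.exp ((28 - d.c / 2) * d.Y) := by
      rw [← Real.exp_add]; congr 1; ring
    rw [e]
    nlinarith [Real.exp_pos ((28 - d.c / 2) * d.Y)]
  calc _ ≤ Real.exp (12 * d.Y) * Real.exp ((29 - d.c / 2) * d.Y) := by gcongr
    _ = _ := by rw [← Real.exp_add]; congr 1; ring

lemma stepC (v : d.I → ℤ) (hvb : ∀ i, |(v i : ℝ)| ≤ Real.exp (19 * d.Y)) (h : d.Small)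
    (hv : ∀ m₀ < 8 * d.k ^ 2, ∀ m₁ < 8 * d.k ^ 2, ∀ x < d.S, d.V v m₀ m₁ (5 * x) = 0)
    (m₀ m₁ : ℕ) (hm₀ : m₀ < 4 * d.k ^ 2) (hm₁ : m₁ < 4 * d.k ^ 2) (X : ℕ) (hX : X < 5 * d.S) :
    d.V v m₀ m₁ X = 0 := by
  by_contra hne
  have hY := d.Y100
  have hc := d.hc
  have hB := d.stepB v hvb h hv m₀ m₁ hm₀ hm₁ X hX
  have hL := liouville5 d.ρ₁ d.ρ₂ d.p₁ d.q₁ d.p₂ d.q₂ d.hq₁ d.hq₂ d.ρ₁_5 d.ρ₂_5 d.ρ₁_pos d.ρ₂_pos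
    (Real.exp d.s) (Real.one_le_exp (by linarith [d.hs])) ⟨d.hp₁', d.hq₁', d.hp₂', d.hq₂'⟩
    (fun i : d.I => v i * d.NN m₀ X i * d.gam i ^ m₁) (fun i => i.2.1 * X) (fun i => i.2.2 * X)
    (50 * d.k * d.S) (by
      intro i
      have h1 := i.2.1.2.le
      have h2 := i.2.2.2.le
      constructor
      · calc (i.2.1 : ℕ) * X ≤ (10 * d.k) * (5 * d.S) := by gcongr
          _ = _ := by ring
      · calc (i.2.2 : ℕ) * X ≤ (10 * d.k) * (5 * d.S) := by gcongr
          _ = _ := by ring) hne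
  have hsum : (∑ i : d.I, |((v i * d.NN m₀ X i * d.gam i ^ m₁ : ℤ) : ℝ)|) ≤ Real.exp (37 * d.Y) := by
    calc _ ≤ ∑ i : d.I, Real.exp (35 * d.Y) := by
          apply Finset.sum_le_sum
          intro i _
          push_cast
          rw [abs_mul, abs_mul, abs_pow]
          have a1 := d.NN_bound m₀ X i (by omega) hX.le
          have a2 := d.gam_pow_bound i m₁ (by omega)
          calc _ ≤ Real.exp (19 * d.Y) * Real.exp (14 * d.Y) * Real.exp (2 * d.Y) := by
                gcongr; exact hvb i
            _ = _ := by rw [← Real.exp_add, ← Real.exp_add]; congr 1; ring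
      _ = Fintype.card d.I * Real.exp (35 * d.Y) := by rw [Finset.sum_const, Finset.card_univ, nsmul_eq_mul]
      _ ≤ Real.exp (2 * d.Y) * Real.exp (35 * d.Y) := by gcongr; exact d.card_I_bound
      _ = _ := by rw [← Real.exp_add]; congr 1; ring
  have hA : (Real.exp d.s) ^ (2 * (50 * d.k * d.S)) ≤ Real.exp d.Y := by
    rw [← Real.exp_nat_mul]
    apply Real.exp_le_exp.2
    push_cast
    have := d.kS_le 100 (by norm_num)
    linarith
  have hfin : (1:ℝ) ≤ Real.exp ((41 - d.c / 2) * d.Y) * (Real.exp (37 * d.Y) * Real.exp d.Y) ^ 25 := by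
    refine hL.trans ?_
    gcongr
    exact hB
  rw [← Real.exp_add, ← Real.exp_nat_mul, ← Real.exp_add, Real.one_le_exp_iff] at hfin
  push_cast at hfin
  nlinarith

end Dat

open Polynomial

lemma vander_fin {ι : Type*} [DecidableEq ι] (s : Finset ι) (γ w : ι → ℝ) (hγ : Set.InjOn γ s) (n : ℕ)
    (hn : s.card ≤ n) (h : ∀ m < n, ∑ i ∈ s, w i * γ i ^ m = 0) : ∀ i ∈ s, w i = 0 := by
  intro i₀ hi₀
  have hp : ∀ p : ℝ[X], p.natDegree < n → ∑ i ∈ s, w i * p.eval (γ i) = 0 := by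
    intro p hp
    have : ∀ i, p.eval (γ i) = ∑ m ∈ Finset.range n, p.coeff m * γ i ^ m := fun i => eval_eq_sum_range' hp _
    simp only [this, Finset.mul_sum]
    rw [Finset.sum_comm]
    apply Finset.sum_eq_zero
    intro m hm
    have := h m (Finset.mem_range.1 hm)
    calc _ = p.coeff m * ∑ i ∈ s, w i * γ i ^ m := by
          rw [Finset.mul_sum]; apply Finset.sum_congr rfl; intros; ring
      _ = 0 := by rw [this, mul_zero]
  let P : ℝ[X] := ∏ j ∈ s.erase i₀, (X - C (γ j))
  have hdeg : P.natDegree < n := by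
    simp only [P]
    rw [natDegree_prod_of_monic _ _ fun i _ => monic_X_sub_C _]
    simp only [natDegree_X_sub_C, Finset.sum_const, smul_eq_mul, mul_one]
    have := Finset.card_erase_lt_of_mem hi₀
    omega
  have h2 := hp P hdeg
  rw [Finset.sum_eq_single_of_mem i₀ hi₀] at h2
  · rcases mul_eq_zero.1 h2 with h | h
    · exact h
    · exfalso
      simp only [P, eval_prod, eval_sub, eval_X, eval_C] at h
      rw [Finset.prod_eq_zero_iff] at h
      obtain ⟨j, hj, hj'⟩ := h
      rw [Finset.mem_erase] at hj
      exact hj.1 (hγ hj.2 hi₀ (sub_eq_zero.1 hj').symm)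
  · intro j hj hne
    simp only [P, eval_prod, eval_sub, eval_X, eval_C]
    rw [Finset.prod_eq_zero (i := j) (Finset.mem_erase.2 ⟨hne, hj⟩) (by simp)]
    simp

lemma poly_zero (P : ℚ[X]) (n S : ℕ) (hdeg : P.natDegree < n * S)
    (h : ∀ m < n, ∀ x < S, (hasseDeriv m P).eval ((5 * x + 1 : ℕ) : ℚ) = 0) : P = 0 := by
  by_contra hP
  have h1 : ∀ x ∈ Finset.range S, (X - C ((5 * x + 1 : ℕ) : ℚ)) ^ n ∣ P := by
    intro x hx
    have h2 : X ^ n ∣ taylor ((5 * x + 1 : ℕ) : ℚ) P := by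
      rw [X_pow_dvd_iff]
      intro m hm
      rw [taylor_coeff]; exact h m hm x (Finset.mem_range.1 hx)
    obtain ⟨Q, hQ⟩ := h2
    refine ⟨taylor (-((5 * x + 1 : ℕ) : ℚ)) Q, ?_⟩
    have h3 := congrArg (taylor (-((5 * x + 1 : ℕ) : ℚ))) hQ
    rw [taylor_taylor, neg_add_cancel, taylor_zero] at h3
    rw [h3, taylor_mul, taylor_pow, taylor_X, map_neg, sub_eq_add_neg]
  have h2 : ∏ x ∈ Finset.range S, (X - C ((5 * x + 1 : ℕ) : ℚ)) ^ n ∣ P := by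
    apply Finset.prod_dvd_of_coprime _ h1
    intro x _ y _ hxy
    apply IsCoprime.pow
    apply isCoprime_X_sub_C_of_isUnit_sub
    rw [isUnit_iff_ne_zero, sub_ne_zero]
    intro h
    have : (5 * x + 1 : ℕ) = 5 * y + 1 := by exact_mod_cast h
    apply hxy; omega
  have h3 := natDegree_le_of_dvd h2 hP
  rw [natDegree_prod_of_monic _ _ fun i _ => (monic_X_sub_C _).pow _] at h3
  simp only [natDegree_pow, natDegree_X_sub_C, mul_one, Finset.sum_const, Finset.card_range, smul_eq_mul] at h3
  rw [mul_comm] at h3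
  omega

lemma card_class (k : ℕ) (r : ℕ) : (Finset.univ.filter fun x : Fin (10 * k) => (x : ℕ) % 5 = r).card ≤ 2 * k := by
  calc _ ≤ (Finset.range (2 * k)).card := by
        apply Finset.card_le_card_of_injOn (fun x : Fin (10 * k) => (x : ℕ) / 5)
        · intro x hx
          simp only [Finset.coe_range, Set.mem_Iio]
          have := x.2
          omega
        · intro x hx y hy hxy
          simp only [Finset.coe_filter, Finset.mem_univ, true_and] at hx hy
          have hx' : (x : ℕ) % 5 = r := hx
          have hy' : (y : ℕ) % 5 = r := hy
          simp only at hxy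
          apply Fin.ext
          omega
    _ = _ := Finset.card_range _

namespace Dat
variable (d : Dat)

lemma stepD (hK : ∀ (i j : ℤ) (c : ℚ), d.ρ₁ ^ i * d.ρ₂ ^ j = c → 5 ∣ i ∧ 5 ∣ j)
    (hdist : ∀ c₁ c₂ : ℤ, |c₁| < 10 * d.k → |c₂| < 10 * d.k → c₁ * d.b₂ = c₂ * d.b₁ → c₁ = 0 ∧ c₂ = 0)
    (v : d.I → ℤ)
    (hv : ∀ m₀ < 4 * d.k ^ 2, ∀ m₁ < 4 * d.k ^ 2, ∀ X < 5 * d.S, d.V v m₀ m₁ X = 0) : v = 0 := by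
  classical
  have key : ∀ (l : Fin (10 * d.k) × Fin (10 * d.k)), ∀ m₀ < 4 * d.k ^ 2, ∀ x < d.S,
      ∑ ab : Fin d.S × Fin (2 * d.k ^ 2), (v (ab, l) * d.NN m₀ (5 * x + 1) (ab, l) : ℤ) = 0 := by
    intro l m₀ hm₀ x hx
    set X := 5 * x + 1 with hX
    have hd0 : 0 < d.S := d.hS
    have hk0 : 0 < 2 * d.k ^ 2 := by
      by_contra h0
      have : 2 * d.k ^ 2 = 0 := by omega
      have : 4 * d.k ^ 2 = 0 := by omega
      omega
    let ab₀ : Fin d.S × Fin (2 * d.k ^ 2) := (⟨0, hd0⟩, ⟨0, hk0⟩)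
    let w : Fin (10 * d.k) × Fin (10 * d.k) → ℝ := fun l' =>
      ((∑ ab : Fin d.S × Fin (2 * d.k ^ 2), (v (ab, l') * d.NN m₀ X (ab, l') : ℤ) : ℤ) : ℝ) *
        (d.ρ₁ ^ (l'.1 * X) * d.ρ₂ ^ (l'.2 * X))
    let g : Fin (10 * d.k) × Fin (10 * d.k) → ℝ := fun l' => (d.gam (ab₀, l') : ℝ)
    let s : Finset (Fin (10 * d.k) × Fin (10 * d.k)) :=
      (Finset.univ.filter fun y : Fin (10 * d.k) => (y : ℕ) % 5 = (l.1 : ℕ) % 5) ×ˢ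
      (Finset.univ.filter fun y : Fin (10 * d.k) => (y : ℕ) % 5 = (l.2 : ℕ) % 5)
    have hw : w l = 0 := by
      apply vander_fin s g w ?_ (4 * d.k ^ 2) ?_ ?_ l ?_
      · intro l₁ _ l₂ _ h12
        simp only [g] at h12
        have h12' : d.gam (ab₀, l₁) = d.gam (ab₀, l₂) := by exact_mod_cast h12
        simp only [gam] at h12'
        have h3 := hdist ((l₁.1 : ℕ) - (l₂.1 : ℕ) : ℤ) ((l₁.2 : ℕ) - (l₂.2 : ℕ) : ℤ)
          (by have := l₁.1.2; have := l₂.1.2; rw [abs_lt]; constructor <;> omega)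
          (by have := l₁.2.2; have := l₂.2.2; rw [abs_lt]; constructor <;> omega)
          (by linarith)
        apply Prod.ext
        · apply Fin.ext; have := h3.1; omega
        · apply Fin.ext; have := h3.2; omega
      · rw [Finset.card_product]
        calc _ ≤ (2 * d.k) * (2 * d.k) := Nat.mul_le_mul (card_class _ _) (card_class _ _)
          _ = _ := by ring
      · intro m₁ hm₁
        have hV := hv m₀ hm₀ m₁ hm₁ X (by omega)
        unfold V at hV
        have hsep := sep d.ρ₁ d.ρ₂ (d.p₁ / d.q₁) (d.p₂ / d.q₂) (by push_cast; exact d.ρ₁_5)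
          (by push_cast; exact d.ρ₂_5) d.ρ₁_pos d.ρ₂_pos hK
          (fun i : d.I => ((v i * d.NN m₀ X i * d.gam i ^ m₁ : ℤ) : ℚ)) (fun i => i.2.1 * X) (fun i => i.2.2 * X)
          (by rw [← hV]; apply Finset.sum_congr rfl; intro i _; push_cast; rfl) (ab₀, l)
        have hfil : (Finset.univ.filter fun i : d.I => ((i.2.1 : ℕ) * X % 5 = ((ab₀, l) : d.I).2.1 * X % 5 ∧
            (i.2.2 : ℕ) * X % 5 = ((ab₀, l) : d.I).2.2 * X % 5)) = Finset.univ ×ˢ s := by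
          ext i
          simp only [Finset.mem_filter, Finset.mem_univ, true_and, Finset.mem_product, s]
          rw [hX]
          have e : ∀ y : ℕ, y * (5 * x + 1) % 5 = y % 5 := by
            intro y
            have : y * (5 * x + 1) = y + 5 * (y * x) := by ring
            rw [this]; omega
          rw [e, e, e, e]
        rw [hfil, Finset.sum_product_right] at hsep
        rw [← hsep]
        apply Finset.sum_congr rfl
        intro l' _
        simp only [w, g]
        push_cast
        rw [Finset.sum_mul, Finset.sum_mul]
        apply Finset.sum_congr rfl
        intro ab _
        have : d.gam (ab, l') = d.gam (ab₀, l') := rfl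
        rw [this]
        ring
      · simp [s]
    simp only [w] at hw
    rcases mul_eq_zero.1 hw with h | h
    · exact_mod_cast h
    · exfalso
      have := d.ρ₁_pos
      have := d.ρ₂_pos
      have : 0 < d.ρ₁ ^ (l.1 * X) * d.ρ₂ ^ (l.2 * X) := by positivity
      exact this.ne' h
  have hfin : ∀ l : Fin (10 * d.k) × Fin (10 * d.k), (fun ab : Fin d.S × Fin (2 * d.k ^ 2) => (v (ab, l) : ℚ)) = 0 := by
    intro l
    apply Qp_indep
    apply poly_zero _ (4 * d.k ^ 2) d.S
    · have hk0 : 0 < d.k := by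
        have := d.k100
        have h : (0:ℝ) < d.k := by linarith
        exact_mod_cast h
      have hS := d.hS
      have : (∑ i : Fin d.S × Fin (2 * d.k ^ 2), C (v (i, l) : ℚ) * Qp d.S i.1 i.2).natDegree ≤ 2 * d.k ^ 2 * d.S := by
        apply natDegree_sum_le_of_forall_le
        intro i _
        refine (natDegree_C_mul_le _ _).trans ?_
        rw [(Qp_natDegree _ _ _).1]
        have h1 := i.1.2
        have h2 := i.2.2
        calc (i.1 : ℕ) + d.S * i.2 ≤ d.S + d.S * i.2 := by omega
          _ = ((i.2 : ℕ) + 1) * d.S := by ring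
          _ ≤ _ := by gcongr; omega
      have h0 : 0 < d.k ^ 2 * d.S := by positivity
      have e1 : 4 * d.k ^ 2 * d.S = 4 * (d.k ^ 2 * d.S) := by ring
      have e2 : 2 * d.k ^ 2 * d.S = 2 * (d.k ^ 2 * d.S) := by ring
      omega
    · intro m hm x hx
      have h1 := key l m hm x hx
      have hν : (d.ν : ℚ) ^ m ≠ 0 := pow_ne_zero _ (by exact_mod_cast d.hν0.ne')
      apply mul_left_cancel₀ hν
      rw [mul_zero]
      have h2 := congrArg (fun z : ℤ => (z : ℚ)) h1
      push_cast at h2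
      rw [← h2, map_sum, eval_finsetSum, Finset.mul_sum]
      apply Finset.sum_congr rfl
      intro ab _
      have h3 := d.NN_spec m (5 * x + 1) (ab, l)
      push_cast at h3
      rw [h3, ← smul_eq_C_mul, map_smul, eval_smul, smul_eq_mul]
      push_cast
      ring
  funext i
  have := congrFun (hfin i.2) i.1
  simpa using this

theorem core (hK : ∀ (i j : ℤ) (c : ℚ), d.ρ₁ ^ i * d.ρ₂ ^ j = c → 5 ∣ i ∧ 5 ∣ j)
    (hdist : ∀ c₁ c₂ : ℤ, |c₁| < 10 * d.k → |c₂| < 10 * d.k → c₁ * d.b₂ = c₂ * d.b₁ → c₁ = 0 ∧ c₂ = 0) :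
    ¬ d.Small := by
  intro h
  obtain ⟨v, hv0, hvb, hv⟩ := d.stepA
  exact hv0 (d.stepD hK hdist v fun m₀ hm₀ m₁ hm₁ X hX => d.stepC v hvb h hv m₀ m₁ hm₀ hm₁ X hX)

end Dat


namespace BV

noncomputable def ht (x : ℚ) : ℝ := Real.log (max (x.num.natAbs : ℝ) (x.den : ℝ))

lemma one_le_mx (x : ℚ) : (1:ℝ) ≤ max (x.num.natAbs : ℝ) (x.den : ℝ) :=
  le_max_of_le_right (by exact_mod_cast x.pos)

lemma ht_nonneg (x : ℚ) : 0 ≤ ht x := Real.log_nonneg (one_le_mx x)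

lemma ht_le (x : ℚ) (a b : ℕ) (ha : 0 < a) (hb : 0 < b) (h : x = a / b) (M : ℝ)
    (h1 : (a:ℝ) ≤ M) (h2 : (b:ℝ) ≤ M) : ht x ≤ Real.log M := by
  apply Real.log_le_log (lt_of_lt_of_le one_pos (one_le_mx x))
  apply max_le
  · refine le_trans ?_ h1
    have : x.num ∣ (a:ℤ) := by
      have := Rat.num_dvd (a:ℤ) (b := (b:ℤ)) (by exact_mod_cast hb.ne')
      rw [h]; rw [Rat.divInt_eq_div] at this; simpa only [Int.cast_natCast] using this
    have := Nat.le_of_dvd ha (Int.natAbs_dvd_natAbs.2 this)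
    exact_mod_cast this
  · refine le_trans ?_ h2
    have : (x.den:ℤ) ∣ (b:ℤ) := by
      have := Rat.den_dvd (a:ℤ) (b:ℤ)
      rw [h]; rw [Rat.divInt_eq_div] at this; simpa only [Int.cast_natCast] using this
    have := Nat.le_of_dvd hb (Int.natCast_dvd_natCast.1 this)
    exact_mod_cast this

lemma rep (x : ℚ) (hx : 0 < x) : x = (x.num.natAbs : ℚ) / x.den ∧ 0 < x.num.natAbs := by
  have h := Rat.num_pos.2 hx
  constructor
  · conv_lhs => rw [← Rat.num_div_den x]
    congr 1
    have : ((x.num.natAbs : ℤ)) = x.num := Int.natAbs_of_nonneg h.le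
    have h2 := congrArg (fun z : ℤ => (z:ℚ)) this.symm
    simpa only [Int.cast_natCast] using h2
  · omega

lemma num_le (x : ℚ) : (x.num.natAbs : ℝ) ≤ Real.exp (ht x) := by
  rw [ht, Real.exp_log (lt_of_lt_of_le one_pos (one_le_mx x))]; exact le_max_left _ _
lemma den_le (x : ℚ) : (x.den : ℝ) ≤ Real.exp (ht x) := by
  rw [ht, Real.exp_log (lt_of_lt_of_le one_pos (one_le_mx x))]; exact le_max_right _ _

lemma ht_mul (x y : ℚ) (hx : 0 < x) (hy : 0 < y) : ht (x * y) ≤ ht x + ht y := by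
  obtain ⟨h1, h1'⟩ := rep x hx
  obtain ⟨h2, h2'⟩ := rep y hy
  rw [← Real.log_exp (ht x + ht y), Real.exp_add]
  apply ht_le _ (x.num.natAbs * y.num.natAbs) (x.den * y.den) (by positivity) (by have := x.pos; have := y.pos; positivity)
  · conv_lhs => rw [h1, h2]
    push_cast
    rw [div_mul_div_comm]
  · push_cast
    have := num_le x; have := num_le y
    gcongr
  · push_cast
    have := den_le x; have := den_le y
    gcongr

lemma ht_inv (x : ℚ) (hx : 0 < x) : ht x⁻¹ ≤ ht x := by
  obtain ⟨h1, h1'⟩ := rep x hx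
  rw [← Real.log_exp (ht x)]
  apply ht_le _ x.den x.num.natAbs x.pos h1' _ _ (den_le x) (num_le x)
  conv_lhs => rw [h1]
  rw [inv_div]

lemma ht_pow (x : ℚ) (hx : 0 < x) (n : ℕ) : ht (x ^ n) ≤ n * ht x := by
  induction n with
  | zero => simp [ht]
  | succ n ih =>
    rw [pow_succ]
    refine (ht_mul _ _ (by positivity) hx).trans ?_
    push_cast; linarith

lemma ht_zpow (x : ℚ) (hx : 0 < x) (n : ℤ) : ht (x ^ n) ≤ |(n:ℝ)| * ht x := by
  obtain ⟨m, rfl | rfl⟩ := n.eq_nat_or_neg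
  · have := ht_pow x hx m
    simpa using this
  · have := (ht_inv _ (show 0 < x ^ m by positivity)).trans (ht_pow x hx m)
    simpa using this

lemma ht_pow5 (x : ℚ) : ht (x ^ 5) = 5 * ht x := by
  unfold ht
  rw [Rat.num_pow, Rat.den_pow, Int.natAbs_pow]
  push_cast
  rw [← (pow_left_monotoneOn (n := 5)).map_max (by simp) (by simp)]
  · rw [Real.log_pow]; norm_num

lemma log_lb (x : ℚ) (hx : 0 < x) (h1 : x ≠ 1) : Real.exp (- ht x) ≤ |Real.log x| := by
  have key : ∀ y : ℚ, 1 < y → Real.exp (- ht y) ≤ |Real.log y| := by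
    intro y hy
    have hy0 : 0 < y := by linarith
    obtain ⟨h2, h2'⟩ := rep y hy0
    have hy' : (1:ℝ) < y := by exact_mod_cast hy
    have hn := num_le y
    have hnp : (0:ℝ) < y.num.natAbs := by exact_mod_cast h2'
    have h3 := Real.one_sub_inv_le_log_of_pos (show (0:ℝ) < y by linarith)
    have h4 : (y:ℝ)⁻¹ = y.den / y.num.natAbs := by
      have := congrArg (fun z : ℚ => (z:ℝ)⁻¹) h2
      simp only [Rat.cast_div, Rat.cast_natCast, inv_div] at this
      exact this
    have h5 : (y.den:ℝ) + 1 ≤ y.num.natAbs := by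
      have : y.den < y.num.natAbs := by
        rw [h2, one_lt_div (by exact_mod_cast y.pos)] at hy
        exact_mod_cast hy
      exact_mod_cast this
    rw [abs_of_pos (Real.log_pos hy'), Real.exp_neg]
    calc _ ≤ (y.num.natAbs : ℝ)⁻¹ := by gcongr
      _ ≤ 1 - (y:ℝ)⁻¹ := by rw [h4, inv_eq_one_div, ← div_self hnp.ne', ← sub_div]; rw [div_self hnp.ne']; gcongr; linarith
      _ ≤ _ := h3
  rcases lt_or_gt_of_ne h1 with h | h
  · have := key x⁻¹ ((one_lt_inv₀ hx).2 h)
    have h2 := ht_inv x hx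
    rw [Rat.cast_inv, Real.log_inv, abs_neg] at this
    refine le_trans ?_ this
    gcongr
  · exact key x h

lemma liou (x y : ℚ) (hx : 0 < x) (hy : 0 < y) (s : ℝ) (hxs : ht x ≤ s) (hys : ht y ≤ s) (c₁ c₂ : ℤ)
    (h : (c₁:ℝ) * Real.log x + c₂ * Real.log y ≠ 0) :
    Real.exp (-((|(c₁:ℝ)| + |(c₂:ℝ)|) * s)) ≤ |(c₁:ℝ) * Real.log x + c₂ * Real.log y| := by
  have hx' : (0:ℝ) < x := by exact_mod_cast hx
  have hy' : (0:ℝ) < y := by exact_mod_cast hy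
  have e : (c₁:ℝ) * Real.log x + c₂ * Real.log y = Real.log ((x ^ c₁ * y ^ c₂ : ℚ) : ℝ) := by
    push_cast
    rw [Real.log_mul (by positivity) (by positivity), Real.log_zpow, Real.log_zpow]
  rw [e] at h ⊢
  refine le_trans ?_ (log_lb _ (by positivity) ?_)
  · gcongr
    refine (ht_mul _ _ (by positivity) (by positivity)).trans ?_
    have h1 := ht_zpow x hx c₁
    have h2 := ht_zpow y hy c₂
    have h3 := mul_le_mul_of_nonneg_left hxs (abs_nonneg (c₁:ℝ))
    have h4 := mul_le_mul_of_nonneg_left hys (abs_nonneg (c₂:ℝ))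
    linarith
  · intro h'
    rw [h'] at h; simp at h

lemma ht_small (x : ℚ) (hx : 0 < x) (h : ht x < Real.log 2) : x = 1 := by
  have h1 := (Real.log_lt_log_iff (lt_of_lt_of_le one_pos (one_le_mx x)) two_pos).1 h
  obtain ⟨e, h0⟩ := rep x hx
  have h2 : x.num.natAbs < 2 := by exact_mod_cast (max_lt_iff.1 h1).1
  have h3 : x.den < 2 := by exact_mod_cast (max_lt_iff.1 h1).2
  have h4 := x.pos
  rw [e, show x.num.natAbs = 1 by omega, show x.den = 1 by omega]; norm_num

lemma desc (x y c : ℚ) (hx : 0 < x) (hy : 0 < y) (i j : ℤ) (h : x ^ i * y ^ j = c ^ 5) (hn : ¬ (5 ∣ i ∧ 5 ∣ j)) :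
    (∃ z : ℚ, 0 < z ∧ x = z ^ 5) ∨ (∃ z : ℚ, 0 < z ∧ ∃ e : ℤ, |e| ≤ 2 ∧ x ^ e * y = z ^ 5) := by
  have inv5 : ∀ j : ℤ, ¬ 5 ∣ j → ∃ u v : ℤ, u * j = 1 + 5 * v := by
    intro j hj
    have : j % 5 = 1 ∨ j % 5 = 2 ∨ j % 5 = 3 ∨ j % 5 = 4 := by omega
    rcases this with h | h | h | h
    · exact ⟨1, j / 5, by omega⟩
    · exact ⟨3, (3 * j - 1) / 5, by omega⟩
    · exact ⟨2, (2 * j - 1) / 5, by omega⟩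
    · exact ⟨4, (4 * j - 1) / 5, by omega⟩
  have hc : 0 < c := (Odd.pow_pos_iff (by decide : Odd 5)).1 (h ▸ by positivity)
  have hc5 : ∀ z : ℚ, z ^ 5 = z ^ (5:ℤ) := fun z => by norm_cast
  rw [hc5] at h
  by_cases hj : 5 ∣ j
  · left
    have hi : ¬ 5 ∣ i := fun hi => hn ⟨hi, hj⟩
    obtain ⟨u, v, huv⟩ := inv5 i hi
    obtain ⟨w, rfl⟩ := hj
    refine ⟨c ^ u * y ^ (-(w * u)) * x ^ (-v), by positivity, ?_⟩
    rw [hc5, mul_zpow, mul_zpow, ← zpow_mul, mul_comm u, zpow_mul, ← h, mul_zpow, ← zpow_mul, ← zpow_mul, ← zpow_mul, ← zpow_mul,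
      mul_comm i, huv]
    have : x ^ (1 + 5 * v) * y ^ (5 * w * u) * y ^ (-(w * u) * 5) * x ^ (-v * 5) = (x ^ (1 + 5 * v) * x ^ (-v * 5)) * (y ^ (5 * w * u) * y ^ (-(w * u) * 5)) := by ring
    rw [this, ← zpow_add₀ hx.ne', ← zpow_add₀ hy.ne']
    rw [show 1 + 5 * v + -v * 5 = 1 by ring, show 5 * w * u + -(w * u) * 5 = 0 by ring]; simp
  · right
    obtain ⟨u, v, huv⟩ := inv5 j hj
    obtain ⟨e, w, he, hw⟩ : ∃ e w : ℤ, |e| ≤ 2 ∧ i * u = e + 5 * w := by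
      refine ⟨(i * u + 2) % 5 - 2, (i * u + 2) / 5, ?_, ?_⟩
      · rw [abs_le]; constructor <;> omega
      · omega
    refine ⟨c ^ u * y ^ (-v) * x ^ (-w), by positivity, e, he, ?_⟩
    rw [hc5, mul_zpow, mul_zpow, ← zpow_mul, mul_comm u, zpow_mul, ← h, mul_zpow, ← zpow_mul, ← zpow_mul, ← zpow_mul, ← zpow_mul,
      hw, mul_comm j, huv]
    have : x ^ (e + 5 * w) * y ^ (1 + 5 * v) * y ^ (-v * 5) * x ^ (-w * 5) = (x ^ (e + 5 * w) * x ^ (-w * 5)) * (y ^ (1 + 5 * v) * y ^ (-v * 5)) := by ring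
    rw [this, ← zpow_add₀ hx.ne', ← zpow_add₀ hy.ne']
    rw [show e + 5 * w + -w * 5 = e by ring, show 1 + 5 * v + -v * 5 = 1 by ring]; simp

def Kum (x y : ℚ) : Prop := ∀ (i j : ℤ) (c : ℚ), x ^ i * y ^ j = c ^ 5 → 5 ∣ i ∧ 5 ∣ j

set_option maxHeartbeats 2000000 in
lemma core_case : ∃ C₀ : ℝ, 2 ≤ C₀ ∧ ∀ (x y : ℚ) (b₁ b₂ : ℤ) (s t : ℝ), 0 < x → 0 < y → 1 ≤ s → 1 ≤ t → Real.log s ≤ t →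
    ht x ≤ s → ht y ≤ s → |(b₁:ℝ)| ≤ Real.exp t → |(b₂:ℝ)| ≤ Real.exp t → Kum x y →
    (b₁:ℝ) * Real.log x + b₂ * Real.log y ≠ 0 →
    Real.exp (-(C₀ * s ^ 2 * t)) ≤ |(b₁:ℝ) * Real.log x + b₂ * Real.log y| := by
  set E : ℝ := Real.exp 2000 with hE
  have hE1 : 2001 ≤ E := by have := Real.add_one_le_exp (2000:ℝ); linarith
  clear_value E
  set W : ℝ := 101 * E with hW
  set V : ℝ := Real.log (20 * W) + 4 with hV
  have hlW : 0 ≤ Real.log (20 * W) := Real.log_nonneg (by linarith)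
  refine ⟨38 * (E * V * W ^ 2), ?_, ?_⟩
  · have : 1 ≤ E * V * W ^ 2 := one_le_mul_of_one_le_of_one_le (one_le_mul_of_one_le_of_one_le (by linarith) (by linarith)) (one_le_pow₀ (by linarith))
    linarith
  intro x y b₁ b₂ s t hx hy hs ht1 hst hxs hys hb₁ hb₂ hK hne
  obtain ⟨k, hk1, hk2⟩ : ∃ k : ℕ, 100 * E * s ≤ k ∧ (k:ℝ) ≤ W * s := by
    refine ⟨⌈100 * E * s⌉₊, Nat.le_ceil _, (Nat.ceil_lt_add_one (by positivity)).le.trans ?_⟩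
    rw [hW]; nlinarith
  have hk0 : (1:ℝ) ≤ k := by nlinarith
  have hkp : 0 < k := by exact_mod_cast (by linarith : (0:ℝ) < k)
  set Λ := (b₁:ℝ) * Real.log x + b₂ * Real.log y with hΛ
  by_cases hdist : ∀ c₁ c₂ : ℤ, |c₁| < 10 * k → |c₂| < 10 * k → c₁ * b₂ = c₂ * b₁ → c₁ = 0 ∧ c₂ = 0
  · have hb₂0 : b₂ ≠ 0 := by
      rintro rfl
      have := (hdist 1 0 (by simp; omega) (by simp; omega) (by simp)).1
      omega
    obtain ⟨S, hS1, hS2, hS3⟩ : ∃ S : ℕ, 1 ≤ S ∧ 10 * k * (|(b₁:ℝ)| + |(b₂:ℝ)|) ≤ Real.exp S ∧ (S:ℝ) ≤ V * t := by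
      have hs0 : 0 < s := by linarith
      refine ⟨⌈Real.log (20 * W) + Real.log s + t⌉₊ + 1, by omega, ?_, ?_⟩
      · have h1 := Nat.le_ceil (Real.log (20 * W) + Real.log s + t)
        have h2 : Real.exp (Real.log (20 * W) + Real.log s + t) = 20 * W * s * Real.exp t := by
          rw [Real.exp_add, Real.exp_add, Real.exp_log (by linarith), Real.exp_log hs0]
        calc 10 * k * (|(b₁:ℝ)| + |(b₂:ℝ)|) ≤ 10 * (W * s) * (Real.exp t + Real.exp t) := by gcongr
          _ = Real.exp (Real.log (20 * W) + Real.log s + t) := by rw [h2]; ring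
          _ ≤ _ := by apply Real.exp_le_exp.2; push_cast; linarith
      · push_cast
        have h0 := Real.log_nonneg hs
        have h1 := Nat.ceil_lt_add_one (show 0 ≤ Real.log (20 * W) + Real.log s + t by linarith)
        rw [hV]
        nlinarith
    obtain ⟨ν, hν0, hν, hν'⟩ := nu_exists S
    obtain ⟨ex, hx0⟩ := rep x hx
    obtain ⟨ey, hy0⟩ := rep y hy
    let d : Dat := {
      p₁ := x.num.natAbs
      q₁ := x.den
      p₂ := y.num.natAbs
      q₂ := y.den
      hp₁ := hx0
      hq₁ := x.pos
      hp₂ := hy0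
      hq₂ := y.pos
      s := s
      hs := hs
      hp₁' := (num_le x).trans (Real.exp_le_exp.2 hxs)
      hq₁' := (den_le x).trans (Real.exp_le_exp.2 hxs)
      hp₂' := (num_le y).trans (Real.exp_le_exp.2 hys)
      hq₂' := (den_le y).trans (Real.exp_le_exp.2 hys)
      b₁ := b₁
      b₂ := b₂
      hb₂ := hb₂0
      S := S
      k := k
      hS := hS1
      c := 2000
      hc := le_refl _
      hk := by rw [← hE]; exact hk1
      hb := hS2
      ν := ν
      hν0 := hν0
      hν := hν
      hν' := hν' }
    have ex' : (x:ℝ) = (x.num.natAbs:ℝ) / x.den := by simpa only [Rat.cast_div, Rat.cast_natCast] using congrArg (fun z : ℚ => (z:ℝ)) ex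
    have ey' : (y:ℝ) = (y.num.natAbs:ℝ) / y.den := by simpa only [Rat.cast_div, Rat.cast_natCast] using congrArg (fun z : ℚ => (z:ℝ)) ey
    have hl1 : d.l₁ = Real.log x := by rw [ex']; rfl
    have hl2 : d.l₂ = Real.log y := by rw [ey']; rfl
    have hL : d.Lam = Λ := by rw [hΛ, ← hl1, ← hl2]; rfl
    have hx' : (0:ℝ) < x := by exact_mod_cast hx
    have hy' : (0:ℝ) < y := by exact_mod_cast hy
    have hr1 : d.ρ₁ ^ 5 = x := by
      rw [Dat.ρ₁, hl1, ← Real.exp_nat_mul]; push_cast; rw [mul_div_cancel₀ _ (by norm_num), Real.exp_log hx']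
    have hr2 : d.ρ₂ ^ 5 = y := by
      rw [Dat.ρ₂, hl2, ← Real.exp_nat_mul]; push_cast; rw [mul_div_cancel₀ _ (by norm_num), Real.exp_log hy']
    have hns := d.core (by
      intro i j c h
      apply hK i j c
      have h2 := congrArg (fun z : ℝ => z ^ 5) h
      simp only [mul_pow] at h2
      rw [← zpow_natCast, ← zpow_natCast (d.ρ₂ ^ j), ← zpow_mul, ← zpow_mul, mul_comm i, mul_comm j, zpow_mul, zpow_mul, zpow_natCast, zpow_natCast, hr1, hr2] at h2
      exact_mod_cast h2) hdist
    have hns' : Real.exp (-2000 * (4 * S * k ^ 2)) < 10 * k * |Λ| * (E * S + 2 ^ (4 * k ^ 2) * Real.exp (7 * (E * S) * (4 * k ^ 2 : ℕ))) := by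
      have := not_le.1 hns
      rw [hL, Dat.R, Dat.Y, ] at this
      rw [hE]
      exact this
    clear hns hr1 hr2 hL hl1 hl2
    clear d
    have hS1' : (1:ℝ) ≤ S := by exact_mod_cast hS1
    set N : ℝ := E * S * k ^ 2 with hN
    have hk2' : (1:ℝ) ≤ (k:ℝ) ^ 2 := one_le_pow₀ hk0
    have hkk : (k:ℝ) ≤ (k:ℝ) ^ 2 := by nlinarith
    have hES : E ≤ E * S := by nlinarith
    have hNk : 2001 * (k:ℝ) ^ 2 ≤ N := by rw [hN]; gcongr; linarith
    have h1 : E * S ≤ Real.exp (32 * N) := by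
      have := Real.add_one_le_exp (32 * N)
      have : E * S ≤ N := by rw [hN]; nlinarith
      linarith
    have h2 : (2:ℝ) ^ (4 * k ^ 2) * Real.exp (7 * (E * S) * (4 * k ^ 2 : ℕ)) ≤ Real.exp (32 * N) := by
      have e2 : (2:ℝ) ≤ Real.exp 1 := by have := Real.add_one_le_exp (1:ℝ); linarith
      calc _ ≤ Real.exp 1 ^ (4 * k ^ 2) * Real.exp (7 * (E * S) * (4 * k ^ 2 : ℕ)) := by gcongr
        _ = Real.exp (4 * k ^ 2 + 28 * N) := by
          rw [← Real.exp_nat_mul, ← Real.exp_add]; congr 1; push_cast; rw [hN]; ring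
        _ ≤ _ := by gcongr; linarith
    have h3 : 20 * (k:ℝ) ≤ Real.exp N := by
      have := Real.add_one_le_exp N
      linarith
    have h4 : Real.exp (-(4 * N)) ≤ Real.exp (-2000 * (4 * S * k ^ 2)) := by
      gcongr
      have : 2000 * (S * k ^ 2) ≤ N := by
        rw [hN, mul_assoc]; gcongr; linarith
      linarith
    have h5 : Real.exp (-(4 * N)) ≤ |Λ| * Real.exp (33 * N) := by
      calc _ ≤ _ := h4
        _ ≤ _ := hns'.le
        _ ≤ 10 * k * |Λ| * (Real.exp (32 * N) + Real.exp (32 * N)) := by gcongr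
        _ = |Λ| * (20 * k * Real.exp (32 * N)) := by ring
        _ ≤ |Λ| * (Real.exp N * Real.exp (32 * N)) := by gcongr
        _ = _ := by rw [← Real.exp_add]; congr 2; ring
    have h6 : Real.exp (-(38 * N)) ≤ |Λ| := by
      have : Real.exp (-(4 * N)) = Real.exp (-(37 * N)) * Real.exp (33 * N) := by rw [← Real.exp_add]; congr 1; ring
      rw [this] at h5
      have h7 := le_of_mul_le_mul_right h5 (Real.exp_pos _)
      refine le_trans ?_ h7
      gcongr
      · norm_num
    refine le_trans ?_ h6
    apply Real.exp_le_exp.2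
    apply neg_le_neg
    calc 38 * N ≤ 38 * (E * (V * t) * (W * s) ^ 2) := by rw [hN]; gcongr
      _ = _ := by ring
  · push Not at hdist
    obtain ⟨c₁, c₂, hc₁, hc₂, hcc, hc0⟩ := hdist
    have hc₁' : |(c₁:ℝ)| ≤ 10 * k := by exact_mod_cast hc₁.le
    have hc₂' : |(c₂:ℝ)| ≤ 10 * k := by exact_mod_cast hc₂.le
    have hcc' : (c₁:ℝ) * b₂ = c₂ * b₁ := by exact_mod_cast hcc
    set M := (c₁:ℝ) * Real.log x + c₂ * Real.log y with hM
    have e1 : c₁ * Λ = b₁ * M := by rw [hΛ, hM]; linear_combination (Real.log y) * hcc'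
    have e2 : c₂ * Λ = b₂ * M := by rw [hΛ, hM]; linear_combination -(Real.log x) * hcc'
    have key : ∀ c b : ℤ, c ≠ 0 → |(c:ℝ)| ≤ 10 * k → (c:ℝ) * Λ = b * M → Real.exp (-(30 * k * s)) ≤ |Λ| := by
      intro c b hc hcb h
      have hcr : (c:ℝ) ≠ 0 := by exact_mod_cast hc
      have h0 : (b:ℝ) * M ≠ 0 := h ▸ mul_ne_zero hcr hne
      have hM0 : M ≠ 0 := right_ne_zero_of_mul h0
      have hb0 : b ≠ 0 := by exact_mod_cast left_ne_zero_of_mul h0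
      have hb1 : (1:ℝ) ≤ |(b:ℝ)| := by exact_mod_cast Int.one_le_abs hb0
      have hl := liou x y hx hy s hxs hys c₁ c₂ hM0
      have h1 := congrArg abs h
      rw [abs_mul, abs_mul] at h1
      have h2 : Real.exp (-(20 * k * s)) ≤ |M| := by
        refine le_trans ?_ hl
        gcongr
        linarith
      have h3 : 10 * (k:ℝ) ≤ Real.exp (10 * k * s) := by
        have := Real.add_one_le_exp (10 * (k:ℝ) * s)
        nlinarith
      have h4 : |M| ≤ Real.exp (10 * k * s) * |Λ| := by
        calc |M| ≤ |(b:ℝ)| * |M| := le_mul_of_one_le_left (abs_nonneg _) hb1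
          _ = |(c:ℝ)| * |Λ| := h1.symm
          _ ≤ _ := by gcongr; linarith
      have h5 : Real.exp (-(20 * k * s)) = Real.exp (10 * k * s) * Real.exp (-(30 * k * s)) := by
        rw [← Real.exp_add]; congr 1; ring
      have h6 := h2.trans h4
      rw [h5] at h6
      exact le_of_mul_le_mul_left h6 (Real.exp_pos _)
    have : Real.exp (-(30 * k * s)) ≤ |Λ| := by
      by_cases h : c₁ = 0
      · exact key c₂ b₂ (hc0 h) hc₂' e2
      · exact key c₁ b₁ h hc₁' e1
    refine le_trans ?_ this
    apply Real.exp_le_exp.2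
    apply neg_le_neg
    have hEV : 1 ≤ E * V * t := one_le_mul_of_one_le_of_one_le (one_le_mul_of_one_le_of_one_le (by linarith) (by linarith)) ht1
    have hWW : W ≤ W ^ 2 := by nlinarith
    calc 30 * k * s ≤ 38 * (W * s) * s := by gcongr; norm_num
      _ ≤ 38 * (W ^ 2 * s) * s := by gcongr
      _ = 1 * (38 * W ^ 2 * s ^ 2) := by ring
      _ ≤ (E * V * t) * (38 * W ^ 2 * s ^ 2) := by gcongr
      _ = _ := by ring

end BV


namespace BV

lemma descent (C₀ : ℝ) (hC : 2 ≤ C₀) (s : ℝ) (hs : 1 ≤ s)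
    (hcore : ∀ (x y : ℚ) (b₁ b₂ : ℤ) (s t : ℝ), 0 < x → 0 < y → 1 ≤ s → 1 ≤ t → Real.log s ≤ t →
    ht x ≤ s → ht y ≤ s → |(b₁:ℝ)| ≤ Real.exp t → |(b₂:ℝ)| ≤ Real.exp t → Kum x y →
    (b₁:ℝ) * Real.log x + b₂ * Real.log y ≠ 0 →
    Real.exp (-(C₀ * s ^ 2 * t)) ≤ |(b₁:ℝ) * Real.log x + b₂ * Real.log y|) (n : ℕ) :
    ∀ (x y : ℚ) (b₁ b₂ : ℤ) (t : ℝ), 0 < x → 0 < y → 1 ≤ t → Real.log s ≤ t →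
    ht x ≤ s → ht y ≤ s → |(b₁:ℝ)| ≤ Real.exp t → |(b₂:ℝ)| ≤ Real.exp t →
    ht x * ht y < (5 / 3) ^ n * Real.log 2 ^ 2 →
    (b₁:ℝ) * Real.log x + b₂ * Real.log y ≠ 0 →
    Real.exp (-(C₀ * s ^ 2 * (t + 2 * n))) ≤ |(b₁:ℝ) * Real.log x + b₂ * Real.log y| := by
  have single : ∀ (x : ℚ) (b : ℤ) (t : ℝ), 0 < x → 1 ≤ t → ht x ≤ s → (b:ℝ) * Real.log x ≠ 0 →
      Real.exp (-(C₀ * s ^ 2 * t)) ≤ |(b:ℝ) * Real.log x| := by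
    intro x b t hx ht1 hxs hne
    have h1 : x ≠ 1 := by rintro rfl; simp at hne
    have hb0 : b ≠ 0 := by exact_mod_cast left_ne_zero_of_mul hne
    have hb1 : (1:ℝ) ≤ |(b:ℝ)| := by exact_mod_cast Int.one_le_abs hb0
    rw [abs_mul]
    calc _ ≤ Real.exp (- ht x) := by
          apply Real.exp_le_exp.2
          apply neg_le_neg
          have : 1 ≤ C₀ * s * t := one_le_mul_of_one_le_of_one_le (one_le_mul_of_one_le_of_one_le (by linarith) hs) ht1
          nlinarith
      _ ≤ |Real.log x| := log_lb x hx h1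
      _ ≤ _ := le_mul_of_one_le_left (abs_nonneg _) hb1
  induction n with
  | zero =>
    intro x y b₁ b₂ t hx hy ht1 hst hxs hys hb₁ hb₂ hprod hne
    simp only [Nat.cast_zero, mul_zero, add_zero]
    have hl2 := Real.log_pos one_lt_two
    by_cases h : ht x < Real.log 2
    · have := ht_small x hx h
      subst this
      simp only [Rat.cast_one, Real.log_one, mul_zero, zero_add] at hne ⊢
      exact single y b₂ t hy ht1 hys hne
    · by_cases h' : ht y < Real.log 2
      · have := ht_small y hy h'
        subst this
        simp only [Rat.cast_one, Real.log_one, mul_zero, add_zero] at hne ⊢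
        exact single x b₁ t hx ht1 hxs hne
      · exfalso
        push Not at h h'
        have := mul_le_mul h h' hl2.le (hl2.le.trans h)
        nlinarith
  | succ n ih =>
    -- reduction with the second argument being the larger one
    have main : ∀ (x y : ℚ) (b₁ b₂ : ℤ) (t : ℝ), 0 < x → 0 < y → 1 ≤ t → Real.log s ≤ t →
      ht x ≤ s → ht y ≤ s → |(b₁:ℝ)| ≤ Real.exp t → |(b₂:ℝ)| ≤ Real.exp t →
      ht x * ht y < (5 / 3) ^ (n + 1) * Real.log 2 ^ 2 →
      (b₁:ℝ) * Real.log x + b₂ * Real.log y ≠ 0 → ht x ≤ ht y → ¬ Kum x y →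
      Real.exp (-(C₀ * s ^ 2 * (t + 2 * (n + 1 : ℕ)))) ≤ |(b₁:ℝ) * Real.log x + b₂ * Real.log y| := by
      intro x y b₁ b₂ t hx hy ht1 hst hxs hys hb₁ hb₂ hprod hne hxy hK
      have he5 : 5 * Real.exp t ≤ Real.exp (t + 2) := by
        rw [Real.exp_add, mul_comm]
        gcongr
        have : Real.exp 2 = Real.exp 1 * Real.exp 1 := by rw [← Real.exp_add]; norm_num
        have h3 := Real.exp_one_gt_d9
        nlinarith
      have het := Real.exp_pos t
      have hx0 := ht_nonneg x
      have hy0 := ht_nonneg y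
      have hprod' : 3 / 5 * (ht x * ht y) < (5 / 3) ^ n * Real.log 2 ^ 2 := by
        rw [pow_succ] at hprod; linarith
      rw [Kum] at hK
      push Not at hK
      obtain ⟨i, j, c, hc, hij⟩ := hK
      rcases desc x y c hx hy i j hc (fun h => hij h.1 h.2) with ⟨z, hz, hzx⟩ | ⟨z, hz, e, he, hzx⟩
      · have hhz : ht x = 5 * ht z := by rw [hzx, ht_pow5]
        have hz0 := ht_nonneg z
        have hlog : Real.log x = 5 * Real.log z := by rw [hzx]; push_cast; rw [Real.log_pow]; norm_num
        have heq : (b₁:ℝ) * Real.log x + b₂ * Real.log y = ((5 * b₁ : ℤ) : ℝ) * Real.log z + b₂ * Real.log y := by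
          rw [hlog]; push_cast; ring
        rw [heq] at hne ⊢
        have := ih z y (5 * b₁) b₂ (t + 2) hz hy (by linarith) (by linarith) (by linarith) hys
          (by push_cast; rw [abs_mul, abs_of_pos (by norm_num : (0:ℝ) < 5)]; linarith) (by linarith)
          (by refine lt_of_le_of_lt ?_ hprod'; rw [hhz]; nlinarith [mul_nonneg hz0 hy0]) hne
        convert this using 3
        push_cast; ring
      · have he' : |(e:ℝ)| ≤ 2 := by exact_mod_cast he
        have hhz : 5 * ht z ≤ 3 * ht y := by
          rw [← ht_pow5, ← hzx]
          refine (ht_mul _ _ (by positivity) hy).trans ?_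
          have := ht_zpow x hx e
          nlinarith
        have hx' : (0:ℝ) < x := by exact_mod_cast hx
        have hy' : (0:ℝ) < y := by exact_mod_cast hy
        have hz0 := ht_nonneg z
        have hlog : e * Real.log x + Real.log y = 5 * Real.log z := by
          have h1 := congrArg (fun w : ℚ => Real.log (w:ℝ)) hzx
          simp only [Rat.cast_mul, Rat.cast_zpow, Rat.cast_pow] at h1
          rw [Real.log_mul (by positivity) (by positivity), Real.log_zpow, Real.log_pow] at h1
          push_cast at h1
          exact h1
        have heq : (b₁:ℝ) * Real.log x + b₂ * Real.log y = ((b₁ - e * b₂ : ℤ) : ℝ) * Real.log x + ((5 * b₂ : ℤ) : ℝ) * Real.log z := by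
          push_cast; linear_combination (b₂:ℝ) * hlog
        rw [heq] at hne ⊢
        have := ih x z (b₁ - e * b₂) (5 * b₂) (t + 2) hx hz (by linarith) (by linarith) hxs (by linarith)
          (by
            push_cast
            have h1 := abs_sub (b₁:ℝ) (e * b₂)
            rw [abs_mul] at h1
            have h2 := mul_le_mul he' hb₂ (abs_nonneg _) (by norm_num)
            linarith)
          (by push_cast; rw [abs_mul, abs_of_pos (by norm_num : (0:ℝ) < 5)]; linarith)
          (by refine lt_of_le_of_lt ?_ hprod'; nlinarith) hne
        convert this using 3
        push_cast; ring
    intro x y b₁ b₂ t hx hy ht1 hst hxs hys hb₁ hb₂ hprod hne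
    by_cases hK : Kum x y
    · refine le_trans ?_ (hcore x y b₁ b₂ s t hx hy hs ht1 hst hxs hys hb₁ hb₂ hK hne)
      gcongr
      have : (0:ℝ) ≤ (n + 1 : ℕ) := by positivity
      linarith
    · rcases le_total (ht x) (ht y) with h | h
      · exact main x y b₁ b₂ t hx hy ht1 hst hxs hys hb₁ hb₂ hprod hne h hK
      · rw [add_comm] at hne
        rw [mul_comm] at hprod
        have := main y x b₂ b₁ t hy hx ht1 hst hys hxs hb₂ hb₁ hprod hne h (by
          intro hK'
          apply hK
          intro i j c hc
          rw [mul_comm] at hc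
          exact (hK' j i c hc).symm)
        rw [add_comm ((b₂:ℝ) * Real.log y)] at this
        exact this

lemma lin_form : ∃ C : ℝ, 2 ≤ C ∧ ∀ (x y : ℚ) (b₁ b₂ : ℤ) (s t : ℝ), 0 < x → 0 < y → 1 ≤ s → 1 ≤ t →
    ht x ≤ s → ht y ≤ s → |(b₁:ℝ)| ≤ Real.exp t → |(b₂:ℝ)| ≤ Real.exp t →
    (b₁:ℝ) * Real.log x + b₂ * Real.log y ≠ 0 →
    Real.exp (-(C * s ^ 2 * t)) ≤ |(b₁:ℝ) * Real.log x + b₂ * Real.log y| := by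
  obtain ⟨C₀, hC, hcore⟩ := core_case
  refine ⟨C₀ * 19, by linarith, ?_⟩
  intro x y b₁ b₂ s t hx hy hs ht1 hxs hys hb₁ hb₂ hne
  have hs0 : 0 < s := by linarith
  by_cases hst : Real.log s ≤ t
  · have hls := Real.log_nonneg hs
    have h1 := Nat.le_ceil (4 + 4 * Real.log s)
    have h2 := Nat.ceil_lt_add_one (show 0 ≤ 4 + 4 * Real.log s by linarith)
    set n := ⌈4 + 4 * Real.log s⌉₊
    have := descent C₀ hC s hs hcore n x y b₁ b₂ t hx hy ht1 hst hxs hys hb₁ hb₂ (by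
      have h3 : Real.exp (1 / 2) ≤ 5 / 3 := by
        have e1 : Real.exp (1 / 2) * Real.exp (1 / 2) = Real.exp 1 := by rw [← Real.exp_add]; norm_num
        have e2 := Real.exp_one_lt_d9
        by_contra h
        push Not at h
        nlinarith
      have h4 : Real.exp 2 * s ^ 2 ≤ (5 / 3) ^ n := by
        calc Real.exp 2 * s ^ 2 = Real.exp (2 + 2 * Real.log s) := by
              rw [Real.exp_add, two_mul (Real.log s), Real.exp_add, Real.exp_log hs0, sq]
          _ ≤ Real.exp (n * (1 / 2)) := by gcongr; linarith
          _ = Real.exp (1 / 2) ^ n := by rw [Real.exp_nat_mul]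
          _ ≤ _ := by gcongr
      have h5 : 1 < Real.exp 2 * Real.log 2 ^ 2 := by
        have e1 : Real.exp 1 * Real.exp 1 = Real.exp 2 := by rw [← Real.exp_add]; norm_num
        have e2 := Real.exp_one_gt_d9
        have e3 := Real.log_two_gt_d9
        have : 1 < Real.exp 1 * Real.log 2 := by nlinarith
        rw [← e1]; nlinarith
      have hl : 0 < Real.log 2 ^ 2 := by have := Real.log_pos one_lt_two; positivity
      calc ht x * ht y ≤ s * s := mul_le_mul hxs hys (ht_nonneg _) hs0.le
        _ = 1 * s ^ 2 := by ring
        _ < (Real.exp 2 * Real.log 2 ^ 2) * s ^ 2 := by gcongr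
        _ = (Real.exp 2 * s ^ 2) * Real.log 2 ^ 2 := by ring
        _ ≤ _ := by gcongr) hne
    refine le_trans ?_ this
    apply Real.exp_le_exp.2
    apply neg_le_neg
    have : 0 ≤ C₀ * s ^ 2 := by positivity
    calc C₀ * s ^ 2 * (t + 2 * n) ≤ C₀ * s ^ 2 * (19 * t) := by gcongr; linarith
      _ = _ := by ring
  · push Not at hst
    have h1 : Real.exp t ≤ s := by
      rw [← Real.exp_log hs0]; exact Real.exp_le_exp.2 hst.le
    refine le_trans ?_ (liou x y hx hy s hxs hys b₁ b₂ hne)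
    apply Real.exp_le_exp.2
    apply neg_le_neg
    calc (|(b₁:ℝ)| + |(b₂:ℝ)|) * s ≤ (s + s) * s := by gcongr <;> linarith
      _ = 2 * s ^ 2 * 1 := by ring
      _ ≤ C₀ * 19 * s ^ 2 * t := by gcongr; linarith

lemma exp_sub_one_lb (z δ : ℝ) (hδ : 0 ≤ δ) (h1 : δ ≤ 1) (h : δ ≤ |z|) : δ / 2 ≤ |Real.exp z - 1| := by
  rcases le_total 0 z with hz | hz
  · rw [abs_of_nonneg hz] at h
    have := Real.add_one_le_exp z
    exact le_trans (by linarith) (le_abs_self _)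
  · rw [abs_of_nonpos hz] at h
    have h2 : Real.exp z ≤ Real.exp (-δ) := Real.exp_le_exp.2 (by linarith)
    have h3 : Real.exp (-δ) ≤ 1 - δ / 2 := by
      have h4 := Real.add_one_le_exp δ
      rw [Real.exp_neg, inv_le_iff_one_le_mul₀ (Real.exp_pos _)]
      nlinarith
    rw [abs_sub_comm]
    exact le_trans (by linarith) (le_abs_self _)

end BV

theorem binomial_value_lower_bound :
    ∃ C₁ : ℝ, 0 < C₁ ∧
      ∀ (a₁ a₂ : ℤ) (β₁ β₂ p q : ℕ) (s t : ℝ),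
        a₁ ≠ 0 → a₂ ≠ 0 → 0 < β₁ → 0 < β₂ → 0 < p → 0 < q →
        1 ≤ s → 1 ≤ t →
        Real.log (max (max (p : ℝ) (q : ℝ)) (max |(a₁ : ℝ)| |(a₂ : ℝ)|)) ≤ s →
        Real.log (max (β₁ : ℝ) (β₂ : ℝ)) ≤ t →
        (a₁ : ℝ) * ((p : ℝ) / (q : ℝ)) ^ ((β₁ : ℝ) / (β₂ : ℝ)) + (a₂ : ℝ) ≠ 0 →
        |(a₁ : ℝ) * ((p : ℝ) / (q : ℝ)) ^ ((β₁ : ℝ) / (β₂ : ℝ)) + (a₂ : ℝ)| ≥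
          Real.exp (-C₁ * t * s ^ 2) := by
  obtain ⟨C, hC, hlin⟩ := BV.lin_form
  refine ⟨C + 2, by linarith, ?_⟩
  intro a₁ a₂ β₁ β₂ p q s t ha₁ ha₂ hβ₁ hβ₂ hp hq hs ht hms hmt hne
  have hpR : (0:ℝ) < p := by exact_mod_cast hp
  have hqR : (0:ℝ) < q := by exact_mod_cast hq
  have hβ₁R : (0:ℝ) < β₁ := by exact_mod_cast hβ₁
  have hβ₂R : (1:ℝ) ≤ β₂ := by exact_mod_cast hβ₂
  have ha₁R : (1:ℝ) ≤ |(a₁:ℝ)| := by exact_mod_cast Int.one_le_abs ha₁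
  have ha₂R : (1:ℝ) ≤ |(a₂:ℝ)| := by exact_mod_cast Int.one_le_abs ha₂
  rw [Real.log_le_iff_le_exp (by positivity)] at hms hmt
  simp only [max_le_iff] at hms hmt
  obtain ⟨⟨hps, hqs⟩, ha₁s, ha₂s⟩ := hms
  obtain ⟨hβ₁t, hβ₂t⟩ := hmt
  set G := ((p : ℝ) / (q : ℝ)) ^ ((β₁ : ℝ) / (β₂ : ℝ)) with hG
  have hG0 : 0 < G := by positivity
  have hs2 : 1 ≤ s ^ 2 := one_le_pow₀ hs
  have hexp1 : Real.exp (-(C + 2) * t * s ^ 2) ≤ 1 := by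
    rw [Real.exp_le_one_iff]
    have : 0 ≤ (C + 2) * t * s ^ 2 := by positivity
    linarith
  -- same signs
  by_cases hsgn : 0 < (a₁:ℝ) * a₂
  · refine hexp1.trans (ha₂R.trans ?_)
    rw [← sq_le_sq]
    nlinarith [mul_pos hsgn hG0, sq_nonneg ((a₁:ℝ) * G)]
  have hsgn' : (a₁:ℝ) * a₂ < 0 := lt_of_le_of_ne (not_lt.1 hsgn) (by
    have : a₁ * a₂ ≠ 0 := mul_ne_zero ha₁ ha₂
    exact_mod_cast this)
  set x : ℚ := (p:ℚ) / q with hx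
  set y : ℚ := (a₂.natAbs : ℚ) / a₁.natAbs with hy
  have hn₁ : 0 < a₁.natAbs := Int.natAbs_pos.2 ha₁
  have hn₂ : 0 < a₂.natAbs := Int.natAbs_pos.2 ha₂
  have hN₁ : ((a₁.natAbs : ℕ) : ℝ) = |(a₁:ℝ)| := by rw [Nat.cast_natAbs]; push_cast; rfl
  have hN₂ : ((a₂.natAbs : ℕ) : ℝ) = |(a₂:ℝ)| := by rw [Nat.cast_natAbs]; push_cast; rfl
  have hx0 : 0 < x := by positivity
  have hy0 : 0 < y := by positivity
  have hxR : (x:ℝ) = p / q := by rw [hx]; push_cast; rfl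
  have hyR : (y:ℝ) = |(a₂:ℝ)| / |(a₁:ℝ)| := by
    rw [hy, Rat.cast_div, Rat.cast_natCast, Rat.cast_natCast, hN₁, hN₂]
  have hhx : BV.ht x ≤ s := by
    rw [← Real.log_exp s]; exact BV.ht_le x p q hp hq hx _ hps hqs
  have hhy : BV.ht y ≤ s := by
    rw [← Real.log_exp s]; exact BV.ht_le y _ _ hn₂ hn₁ hy _ (hN₂ ▸ ha₂s) (hN₁ ▸ ha₁s)
  set Λ : ℝ := (((β₁:ℤ)) : ℝ) * Real.log x + ((-(β₂:ℤ) : ℤ) : ℝ) * Real.log y with hΛ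
  have ha₁0 : (0:ℝ) < |(a₁:ℝ)| := by linarith
  have ha₂0 : (0:ℝ) < |(a₂:ℝ)| := by linarith
  have hxR0 : (0:ℝ) < x := by exact_mod_cast hx0
  have hyR0 : (0:ℝ) < y := by exact_mod_cast hy0
  have hGe : G = Real.exp (Λ / β₂) * y := by
    rw [hG, ← hxR, Real.rpow_def_of_pos hxR0]
    have hly : Real.exp (Λ / β₂) * y = Real.exp (Λ / β₂ + Real.log y) := by
      rw [Real.exp_add, Real.exp_log hyR0]
    rw [hly]
    congr 1
    rw [hΛ]; push_cast
    field_simp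
    ring
  have hval : |(a₁:ℝ) * G + a₂| = |(a₂:ℝ)| * |Real.exp (Λ / β₂) - 1| := by
    have h1 : (a₁:ℝ) * G = -(a₂ * Real.exp (Λ / β₂)) := by
      rw [hGe, hyR]
      rcases lt_or_gt_of_ne (show (a₁:ℝ) ≠ 0 by exact_mod_cast ha₁) with h | h
      · have h2 : 0 < (a₂:ℝ) := by nlinarith
        rw [abs_of_neg h, abs_of_pos h2]; field_simp
      · have h2 : (a₂:ℝ) < 0 := by nlinarith
        rw [abs_of_pos h, abs_of_neg h2]; field_simp
    rw [h1, ← abs_mul, ← abs_neg]; congr 1; ring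
  have hΛ0 : Λ ≠ 0 := by
    intro h
    rw [h] at hval
    simp only [zero_div, Real.exp_zero, sub_self, abs_zero, mul_zero] at hval
    exact hne (abs_eq_zero.1 hval)
  have hlb := hlin x y β₁ (-(β₂:ℤ)) s t hx0 hy0 hs ht hhx hhy
    (by push_cast; rw [abs_of_pos hβ₁R]; exact hβ₁t)
    (by push_cast; rw [abs_neg, abs_of_pos (by linarith)]; exact hβ₂t) hΛ0
  rw [← hΛ] at hlb
  set δ := Real.exp (-((C * s ^ 2 + 1) * t)) with hδ
  have hδ1 : δ ≤ |Λ / β₂| := by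
    rw [abs_div, abs_of_pos (show (0:ℝ) < β₂ by linarith), le_div_iff₀ (by linarith)]
    calc δ * β₂ ≤ δ * Real.exp t := by gcongr
      _ = Real.exp (-(C * s ^ 2 * t)) := by rw [hδ, ← Real.exp_add]; congr 1; ring
      _ ≤ _ := hlb
  have h2 := BV.exp_sub_one_lb _ δ (Real.exp_pos _).le (by
    rw [hδ, Real.exp_le_one_iff]
    have : 0 ≤ (C * s ^ 2 + 1) * t := by positivity
    linarith) hδ1
  rw [ge_iff_le, hval]
  calc Real.exp (-(C + 2) * t * s ^ 2) ≤ Real.exp (-((C * s ^ 2 + 1) * t) + -1) := by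
        apply Real.exp_le_exp.2
        have h3 : t ≤ t * s ^ 2 := le_mul_of_one_le_right (by linarith) hs2
        nlinarith
    _ = δ * Real.exp (-1) := by rw [Real.exp_add]
    _ ≤ δ * (1 / 2) := by
        gcongr
        rw [Real.exp_neg, inv_le_iff_one_le_mul₀ (Real.exp_pos _)]
        have := Real.add_one_le_exp (1:ℝ)
        linarith
    _ = 1 * (δ / 2) := by ring
    _ ≤ _ := by gcongr
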